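/- Let D ≤ −3 be a fundamental discriminant. Then the limit lim_{x→∞} Σ_{p ≤ x} (D/p)·(log p)/(p − 1) (sum over primes p ≤ x) exists and equals −(L'/L)(1, χ_D) + Σ_{k=1}^∞ ( −(L'/L)(2^k, χ_D) + (ζ'/ζ)(2^k) + Σ_{p | D} (log p)/(p^{2^k} − 1) ), where the series over k converges. -/

import Mathlib

open Filter Real
open scoped Classical

/-- The Kronecker symbol `(D/p)` at a prime `p`: it is `0` if `p ∣ D`, equals the
Jacobi symbol `(D|p)` for odd `p ∤ D`, and for `p = 2 ∤ D` equals `1` if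
`D ≡ 1 (mod 8)` and `-1` if `D ≡ 5 (mod 8)`. -/
def kron (D : ℤ) (p : ℕ) : ℤ :=
  if (p : ℤ) ∣ D then 0
  else if p = 2 then (if D % 8 = 1 then 1 else -1)
  else jacobiSym D p

/-- `D` is a fundamental discriminant: either `D ≡ 1 (mod 4)` and `D` is squarefree,
or `D = 4m` with `m` squarefree and `m ≡ 2` or `3 (mod 4)`. -/
def IsFundamentalDiscriminant (D : ℤ) : Prop :=
  (D % 4 = 1 ∧ Squarefree D) ∨
  (∃ m : ℤ, D = 4 * m ∧ Squarefree m ∧ (m % 4 = 2 ∨ m % 4 = 3))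

/-- `S_D`: the multiplicative semigroup generated by the primes `p` with
`(D/p) = 1` together with the squares of the primes `q` with `(D/q) = -1`;
equivalently, the positive integers `n` such that every prime `p ∣ n` has
`(D/p) = 1`, or `(D/p) = -1` and `p` occurs in `n` to an even exponent. -/
def SD (D : ℤ) : Set ℕ :=
  {n : ℕ | 0 < n ∧ ∀ p : ℕ, p.Prime → p ∣ n →
    (kron D p = 1 ∨ (kron D p = -1 ∧ Even (n.factorization p)))}

/-- `χ` is the completely multiplicative function `χ_D` with `χ_D(p) = (D/p)` on
primes. -/
def IsChiD (D : ℤ) (χ : ℕ → ℤ) : Prop :=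
  χ 0 = 0 ∧ χ 1 = 1 ∧ (∀ m n : ℕ, χ (m * n) = χ m * χ n) ∧
    ∀ p : ℕ, p.Prime → χ p = kron D p

/-- `L(s,χ) = ∑_{n ≥ 1} χ(n) n^{-s}` (for real `s > 1`). -/
noncomputable def LChi (χ : ℕ → ℤ) (s : ℝ) : ℝ :=
  ∑' n : ℕ, (χ n : ℝ) * (n : ℝ) ^ (-s)

/-- `L'(s,χ) = -∑_{n ≥ 1} χ(n) (log n) n^{-s}` (for real `s > 1`). -/
noncomputable def LChi' (χ : ℕ → ℤ) (s : ℝ) : ℝ :=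
  -∑' n : ℕ, (χ n : ℝ) * Real.log n * (n : ℝ) ^ (-s)

/-- The Riemann zeta function `ζ(s) = ∑_{n ≥ 1} n^{-s}` (for real `s > 1`). -/
noncomputable def zetaR (s : ℝ) : ℝ := ∑' n : ℕ, (n : ℝ) ^ (-s)

/-- `ζ'(s) = -∑_{n ≥ 1} (log n) n^{-s}` (for real `s > 1`). -/
noncomputable def zetaR' (s : ℝ) : ℝ := -∑' n : ℕ, Real.log n * (n : ℝ) ^ (-s)

theorem boundary_square_inv :
    (∫ x in (-1 : ℝ)..1, ((x : ℂ) + (-1 : ℝ) * Complex.I)⁻¹) -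
      (∫ x in (-1 : ℝ)..1, ((x : ℂ) + (1 : ℝ) * Complex.I)⁻¹) +
      Complex.I • (∫ y in (-1 : ℝ)..1, (((1 : ℝ) : ℂ) + y * Complex.I)⁻¹) -
      Complex.I • (∫ y in (-1 : ℝ)..1, (((-1 : ℝ) : ℂ) + y * Complex.I)⁻¹) =
      2 * π * Complex.I := by
  have hne1 : ∀ x : ℝ, (x : ℂ) + (-1 : ℝ) * Complex.I ≠ 0 := fun x h => by
    simpa using congrArg Complex.im h
  have hne2 : ∀ x : ℝ, (x : ℂ) + (1 : ℝ) * Complex.I ≠ 0 := fun x h => by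
    simpa using congrArg Complex.im h
  have hne3 : ∀ y : ℝ, ((1 : ℝ) : ℂ) + y * Complex.I ≠ 0 := fun x h => by
    simpa using congrArg Complex.re h
  have hne4 : ∀ y : ℝ, ((-1 : ℝ) : ℂ) + y * Complex.I ≠ 0 := fun x h => by
    simpa using congrArg Complex.re h
  have hsq : ∀ x : ℝ, (1 : ℂ) + (x : ℂ) ^ 2 ≠ 0 := fun x h => by
    have : (1 : ℝ) + x ^ 2 = 0 := by exact_mod_cast h
    exact absurd this (by positivity)
  have h1 : (∫ x in (-1 : ℝ)..1, ((x : ℂ) + (-1 : ℝ) * Complex.I)⁻¹) -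
      (∫ x in (-1 : ℝ)..1, ((x : ℂ) + (1 : ℝ) * Complex.I)⁻¹) =
      ∫ x in (-1 : ℝ)..1, 2 * Complex.I * ((1 / (1 + x ^ 2) : ℝ) : ℂ) := by
    rw [← intervalIntegral.integral_sub]
    · refine intervalIntegral.integral_congr fun x _ => ?_
      have a1 : (x : ℂ) - Complex.I ≠ 0 := by simpa [sub_eq_add_neg] using hne1 x
      have a2 : (x : ℂ) + Complex.I ≠ 0 := by simpa using hne2 x
      have a3 : ((x : ℂ) - Complex.I) * (x + Complex.I) = 1 + (x : ℂ) ^ 2 := by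
        linear_combination -Complex.I_sq
      have a4 : (x : ℂ) + (-1 : ℝ) * Complex.I = x - Complex.I := by push_cast; ring
      have a5 : (x : ℂ) + (1 : ℝ) * Complex.I = x + Complex.I := by push_cast; ring
      simp only [a4, a5]
      rw [inv_sub_inv a1 a2, a3]
      push_cast
      ring
    · exact (Continuous.inv₀ (by fun_prop) hne1).intervalIntegrable _ _
    · exact (Continuous.inv₀ (by fun_prop) hne2).intervalIntegrable _ _
  have h2 : (∫ y in (-1 : ℝ)..1, (((1 : ℝ) : ℂ) + y * Complex.I)⁻¹) -
      (∫ y in (-1 : ℝ)..1, (((-1 : ℝ) : ℂ) + y * Complex.I)⁻¹) =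
      ∫ x in (-1 : ℝ)..1, 2 * ((1 / (1 + x ^ 2) : ℝ) : ℂ) := by
    rw [← intervalIntegral.integral_sub]
    · refine intervalIntegral.integral_congr fun x _ => ?_
      have a1 := hne3 x
      have a2 := hne4 x
      have a3 := hsq x
      push_cast at *
      field_simp
      linear_combination (-2 * (x : ℂ) ^ 2) * Complex.I_sq
    · exact (Continuous.inv₀ (by fun_prop) hne3).intervalIntegrable _ _
    · exact (Continuous.inv₀ (by fun_prop) hne4).intervalIntegrable _ _
  rw [add_sub_assoc, ← smul_sub, h1, h2, intervalIntegral.integral_const_mul,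
    intervalIntegral.integral_const_mul, intervalIntegral.integral_ofReal,
    integral_one_div_one_add_sq]
  simp only [arctan_one, arctan_neg, smul_eq_mul]
  push_cast
  ring

/-- Cauchy's integral formula at the centre of a square. -/
theorem boundary_square_div {G : ℂ → ℂ} (hG : Differentiable ℂ G) :
    (∫ x in (-1 : ℝ)..1, G (x + (-1 : ℝ) * Complex.I) / (x + (-1 : ℝ) * Complex.I)) -
      (∫ x in (-1 : ℝ)..1, G (x + (1 : ℝ) * Complex.I) / (x + (1 : ℝ) * Complex.I)) +
      Complex.I • (∫ y in (-1 : ℝ)..1, G ((1 : ℝ) + y * Complex.I) / ((1 : ℝ) + y * Complex.I)) -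
      Complex.I • (∫ y in (-1 : ℝ)..1,
        G ((-1 : ℝ) + y * Complex.I) / ((-1 : ℝ) + y * Complex.I)) =
      2 * π * Complex.I * G 0 := by
  have hne1 : ∀ x : ℝ, (x : ℂ) + (-1 : ℝ) * Complex.I ≠ 0 := fun x h => by
    simpa using congrArg Complex.im h
  have hne2 : ∀ x : ℝ, (x : ℂ) + (1 : ℝ) * Complex.I ≠ 0 := fun x h => by
    simpa using congrArg Complex.im h
  have hne3 : ∀ y : ℝ, ((1 : ℝ) : ℂ) + y * Complex.I ≠ 0 := fun x h => by
    simpa using congrArg Complex.re h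
  have hne4 : ∀ y : ℝ, ((-1 : ℝ) : ℂ) + y * Complex.I ≠ 0 := fun x h => by
    simpa using congrArg Complex.re h
  have hd : Differentiable ℂ (dslope G 0) := by
    have := (Complex.differentiableOn_dslope (s := Set.univ) (f := G) (c := 0)
      Filter.univ_mem).2 hG.differentiableOn
    exact differentiableOn_univ.1 this
  have hrect := Complex.integral_boundary_rect_eq_zero_of_differentiableOn (dslope G 0)
    (-1 - Complex.I) (1 + Complex.I) hd.differentiableOn
  have hG' := hG.continuous
  have key : ∀ z : ℂ, z ≠ 0 → G z / z = dslope G 0 z + G 0 * z⁻¹ := fun z hz => by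
    rw [dslope_of_ne _ hz, slope_def_field]
    field_simp
    ring
  have hdc := hd.continuous
  have split : ∀ φ : ℝ → ℂ, Continuous φ → (∀ x, φ x ≠ 0) →
      ∫ x in (-1 : ℝ)..1, G (φ x) / φ x =
        (∫ x in (-1 : ℝ)..1, dslope G 0 (φ x)) + G 0 * ∫ x in (-1 : ℝ)..1, (φ x)⁻¹ := by
    intro φ hφ hφ0
    rw [← intervalIntegral.integral_const_mul, ← intervalIntegral.integral_add]
    · exact intervalIntegral.integral_congr fun x _ => key _ (hφ0 x)
    · exact (hdc.comp hφ).intervalIntegrable _ _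
    · exact (continuous_const.mul (hφ.inv₀ hφ0)).intervalIntegrable _ _
  rw [split _ (by fun_prop) hne1, split _ (by fun_prop) hne2, split _ (by fun_prop) hne3,
    split _ (by fun_prop) hne4]
  have hinv := boundary_square_inv
  simp only [Complex.sub_re, Complex.neg_re, Complex.one_re, Complex.I_re, Complex.add_re,
    Complex.sub_im, Complex.neg_im, Complex.one_im, Complex.I_im, Complex.add_im, sub_zero,
    add_zero, neg_zero, zero_add, zero_sub] at hrect
  simp only [smul_eq_mul] at *
  linear_combination hrect + G 0 * hinv

/-- If `G` is entire, `P` is holomorphic on the right half of the unit square, and on the boundary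
of the square `G w / w` is small on the left and close to `P w` on the right, then `G 0` is
controlled by the integral of `P` along the imaginary axis. -/
theorem norm_apply_zero_le_of_boundary_square {G P : ℂ → ℂ} {M : ℝ} (hG : Differentiable ℂ G)
    (hPc : ContinuousOn P (Set.Icc 0 1 ×ℂ Set.Icc (-1) 1))
    (hPd : DifferentiableOn ℂ P (Set.Ioo 0 1 ×ℂ Set.Ioo (-1) 1))
    (hl : ∀ w : ℂ, w.re < 0 → |w.re| ≤ 1 → |w.im| ≤ 1 → (w.re = -1 ∨ |w.im| = 1) →
      ‖G w / w‖ ≤ M)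
    (hr : ∀ w : ℂ, 0 < w.re → |w.re| ≤ 1 → |w.im| ≤ 1 → (w.re = 1 ∨ |w.im| = 1) →
      ‖P w - G w / w‖ ≤ M) :
    2 * π * ‖G 0‖ ≤ 8 * M + ‖∫ y in (-1 : ℝ)..1, P (y * Complex.I)‖ := by
  have hne1 : ∀ x : ℝ, (x : ℂ) + (-1 : ℝ) * Complex.I ≠ 0 := fun x h => by
    simpa using congrArg Complex.im h
  have hne2 : ∀ x : ℝ, (x : ℂ) + (1 : ℝ) * Complex.I ≠ 0 := fun x h => by
    simpa using congrArg Complex.im h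
  have hne3 : ∀ y : ℝ, ((1 : ℝ) : ℂ) + y * Complex.I ≠ 0 := fun x h => by
    simpa using congrArg Complex.re h
  have hGc := hG.continuous
  have c1 : Continuous fun x : ℝ => G (x + (-1 : ℝ) * Complex.I) / (x + (-1 : ℝ) * Complex.I) :=
    Continuous.div (by fun_prop) (by fun_prop) hne1
  have c2 : Continuous fun x : ℝ => G (x + (1 : ℝ) * Complex.I) / (x + (1 : ℝ) * Complex.I) :=
    Continuous.div (by fun_prop) (by fun_prop) hne2
  have c3 : Continuous fun y : ℝ => G ((1 : ℝ) + y * Complex.I) / ((1 : ℝ) + y * Complex.I) :=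
    Continuous.div (by fun_prop) (by fun_prop) hne3
  have hrect := Complex.integral_boundary_rect_eq_zero_of_continuousOn_of_differentiableOn P
    (-Complex.I) (1 + Complex.I)
    (by simpa [Set.uIcc_of_le] using hPc) (by simpa using hPd)
  simp only [Complex.neg_re, Complex.neg_im, Complex.one_re, Complex.I_re, Complex.add_re,
    Complex.one_im, Complex.I_im, Complex.add_im, neg_zero, add_zero, zero_add] at hrect
  have hbox := boundary_square_div hG
  rw [← intervalIntegral.integral_add_adjacent_intervals (c1.intervalIntegrable (-1) 0)
      (c1.intervalIntegrable 0 1),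
    ← intervalIntegral.integral_add_adjacent_intervals (c2.intervalIntegrable (-1) 0)
      (c2.intervalIntegrable 0 1)] at hbox
  have i1 : IntervalIntegrable (fun x : ℝ => P (x + (-1 : ℝ) * Complex.I)) MeasureTheory.volume
      0 1 := by
    refine ContinuousOn.intervalIntegrable ?_
    refine hPc.comp (by fun_prop) fun x hx => ?_
    rw [Set.uIcc_of_le zero_le_one] at hx
    simpa [Complex.mem_reProdIm] using hx
  have i2 : IntervalIntegrable (fun x : ℝ => P (x + (1 : ℝ) * Complex.I)) MeasureTheory.volume
      0 1 := by
    refine ContinuousOn.intervalIntegrable ?_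
    refine hPc.comp (by fun_prop) fun x hx => ?_
    rw [Set.uIcc_of_le zero_le_one] at hx
    simpa [Complex.mem_reProdIm] using hx
  have i3 : IntervalIntegrable (fun y : ℝ => P ((1 : ℝ) + y * Complex.I)) MeasureTheory.volume
      (-1) 1 := by
    refine ContinuousOn.intervalIntegrable ?_
    refine hPc.comp (by fun_prop) fun x hx => ?_
    rw [Set.uIcc_of_le (by norm_num)] at hx
    simpa [Complex.mem_reProdIm] using hx
  have s1 := intervalIntegral.integral_sub i1 (c1.intervalIntegrable 0 1)
  have s2 := intervalIntegral.integral_sub i2 (c2.intervalIntegrable 0 1)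
  have s3 := intervalIntegral.integral_sub i3 (c3.intervalIntegrable (-1) 1)
  have b1 := intervalIntegral.norm_integral_le_of_norm_le_const (a := (0 : ℝ)) (b := 1) (C := M)
    (f := fun x : ℝ => P (x + (-1 : ℝ) * Complex.I) -
      G (x + (-1 : ℝ) * Complex.I) / (x + (-1 : ℝ) * Complex.I)) fun x hx => by
      rw [Set.uIoc_of_le zero_le_one] at hx
      exact hr _ (by simpa using hx.1) (by simpa [abs_of_pos hx.1] using hx.2) (by simp) (by simp)
  have b2 := intervalIntegral.norm_integral_le_of_norm_le_const (a := (0 : ℝ)) (b := 1) (C := M)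
    (f := fun x : ℝ => P (x + (1 : ℝ) * Complex.I) -
      G (x + (1 : ℝ) * Complex.I) / (x + (1 : ℝ) * Complex.I)) fun x hx => by
      rw [Set.uIoc_of_le zero_le_one] at hx
      exact hr _ (by simpa using hx.1) (by simpa [abs_of_pos hx.1] using hx.2) (by simp) (by simp)
  have b3 := intervalIntegral.norm_integral_le_of_norm_le_const (a := (-1 : ℝ)) (b := 1) (C := M)
    (f := fun y : ℝ => P ((1 : ℝ) + y * Complex.I) -
      G ((1 : ℝ) + y * Complex.I) / ((1 : ℝ) + y * Complex.I)) fun x hx => by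
      rw [Set.uIoc_of_le (by norm_num)] at hx
      exact hr _ (by simp) (by simp) (by simpa [abs_le] using ⟨hx.1.le, hx.2⟩) (by simp)
  have b4 := intervalIntegral.norm_integral_le_of_norm_le_const_ae (a := (-1 : ℝ)) (b := 0)
    (C := M)
    (f := fun x : ℝ => G (x + (-1 : ℝ) * Complex.I) / (x + (-1 : ℝ) * Complex.I)) (by
      filter_upwards [MeasureTheory.Measure.ae_ne MeasureTheory.volume 0] with x hx0 hx
      rw [Set.uIoc_of_le (by norm_num)] at hx
      have hneg : x < 0 := lt_of_le_of_ne hx.2 hx0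
      exact hl _ (by simpa using hneg) (by simp only [Complex.add_re, Complex.ofReal_re,
        Complex.re_ofReal_mul, Complex.I_re, mul_zero, add_zero, abs_le]
                                           constructor <;> linarith [hx.1]) (by simp) (by simp))
  have b5 := intervalIntegral.norm_integral_le_of_norm_le_const_ae (a := (-1 : ℝ)) (b := 0)
    (C := M)
    (f := fun x : ℝ => G (x + (1 : ℝ) * Complex.I) / (x + (1 : ℝ) * Complex.I)) (by
      filter_upwards [MeasureTheory.Measure.ae_ne MeasureTheory.volume 0] with x hx0 hx
      rw [Set.uIoc_of_le (by norm_num)] at hx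
      have hneg : x < 0 := lt_of_le_of_ne hx.2 hx0
      exact hl _ (by simpa using hneg) (by simp only [Complex.add_re, Complex.ofReal_re,
        Complex.re_ofReal_mul, Complex.I_re, mul_zero, add_zero, abs_le]
                                           constructor <;> linarith [hx.1]) (by simp) (by simp))
  have b6 := intervalIntegral.norm_integral_le_of_norm_le_const (a := (-1 : ℝ)) (b := 1) (C := M)
    (f := fun y : ℝ => G ((-1 : ℝ) + y * Complex.I) / ((-1 : ℝ) + y * Complex.I)) fun x hx => by
      rw [Set.uIoc_of_le (by norm_num)] at hx
      exact hl _ (by simp) (by simp) (by simpa [abs_le] using ⟨hx.1.le, hx.2⟩) (by simp)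
  rw [s1] at b1
  rw [s2] at b2
  rw [s3] at b3
  norm_num only [sub_zero, abs_one, sub_neg_eq_add, zero_add, abs_two, one_add_one_eq_two]
    at b1 b2 b3 b4 b5 b6
  have hP0 : (∫ y in (-1 : ℝ)..1, P (y * Complex.I)) =
      ∫ y in (-1 : ℝ)..1, P ((0 : ℝ) + y * Complex.I) := by simp
  rw [hP0]
  generalize (∫ y in (-1 : ℝ)..1, P ((0 : ℝ) + y * Complex.I)) = P0 at *
  generalize (∫ x in (0 : ℝ)..1, P (x + (-1 : ℝ) * Complex.I)) = P1 at *
  generalize (∫ x in (0 : ℝ)..1, P (x + (1 : ℝ) * Complex.I)) = P2 at *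
  generalize (∫ y in (-1 : ℝ)..1, P ((1 : ℝ) + y * Complex.I)) = P3 at *
  generalize (∫ x in (0 : ℝ)..1, G (x + (-1 : ℝ) * Complex.I) / (x + (-1 : ℝ) * Complex.I)) = R1
    at *
  generalize (∫ x in (0 : ℝ)..1, G (x + (1 : ℝ) * Complex.I) / (x + (1 : ℝ) * Complex.I)) = R2
    at *
  generalize (∫ y in (-1 : ℝ)..1, G ((1 : ℝ) + y * Complex.I) / ((1 : ℝ) + y * Complex.I)) = R3
    at *
  generalize (∫ x in (-1 : ℝ)..0, G (x + (-1 : ℝ) * Complex.I) / (x + (-1 : ℝ) * Complex.I)) = L1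
    at *
  generalize (∫ x in (-1 : ℝ)..0, G (x + (1 : ℝ) * Complex.I) / (x + (1 : ℝ) * Complex.I)) = L2
    at *
  generalize (∫ y in (-1 : ℝ)..1, G ((-1 : ℝ) + y * Complex.I) / ((-1 : ℝ) + y * Complex.I)) = L3
    at *
  simp only [smul_eq_mul] at hbox hrect
  have heq : 2 * π * Complex.I * G 0 = L1 - (P1 - R1) - L2 + (P2 - R2) - Complex.I * (P3 - R3)
      - Complex.I * L3 + Complex.I * P0 := by
    linear_combination hrect - hbox
  have hn : ‖2 * π * Complex.I * G 0‖ = 2 * π * ‖G 0‖ := by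
    simp [abs_of_pos pi_pos]
  rw [← hn, heq]
  have t6 := norm_add_le (L1 - (P1 - R1) - L2 + (P2 - R2) - Complex.I * (P3 - R3)
    - Complex.I * L3) (Complex.I * P0)
  have t5 := norm_sub_le (L1 - (P1 - R1) - L2 + (P2 - R2) - Complex.I * (P3 - R3))
    (Complex.I * L3)
  have t4 := norm_sub_le (L1 - (P1 - R1) - L2 + (P2 - R2)) (Complex.I * (P3 - R3))
  have t3 := norm_add_le (L1 - (P1 - R1) - L2) (P2 - R2)
  have t2 := norm_sub_le (L1 - (P1 - R1)) L2
  have t1 := norm_sub_le L1 (P1 - R1)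
  simp only [norm_mul, Complex.norm_I, one_mul] at t4 t5 t6
  linarith

theorem sum_rpow_sub_one_le {u : ℝ} (hu : 0 < u) {N : ℕ} (hN : 1 ≤ N) :
    ∑ n ∈ Finset.Ioc 0 N, (n : ℝ) ^ (u - 1) ≤ (N : ℝ) ^ u * (1 / N + 1 / u) := by
  rcases le_total u 1 with h1 | h1
  · have key : ∀ N : ℕ, ∑ n ∈ Finset.Ioc 0 N, (n : ℝ) ^ (u - 1) ≤ (N : ℝ) ^ u / u := by
      intro N
      induction N with
      | zero => simp [Real.zero_rpow hu.ne']
      | succ k ih =>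
        rw [Finset.sum_Ioc_succ_top (Nat.zero_le _)]
        have hk : (0 : ℝ) < ((k + 1 : ℕ) : ℝ) := by positivity
        have hb := rpow_one_add_le_one_add_mul_self (s := -1 / ((k + 1 : ℕ) : ℝ)) (p := u)
          (by rw [le_div_iff₀ hk]; push_cast; linarith [Nat.cast_nonneg (α := ℝ) k]) hu.le h1
        have e1 : (k : ℝ) = ((k + 1 : ℕ) : ℝ) * (1 + -1 / ((k + 1 : ℕ) : ℝ)) := by
          field_simp
          push_cast
          ring
        have e0 : 0 ≤ 1 + -1 / ((k + 1 : ℕ) : ℝ) := by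
          have : (0 : ℝ) ≤ k := Nat.cast_nonneg k
          rw [e1] at this
          exact nonneg_of_mul_nonneg_right this hk
        have e2 : (k : ℝ) ^ u ≤ ((k + 1 : ℕ) : ℝ) ^ u * (1 + u * (-1 / ((k + 1 : ℕ) : ℝ))) := by
          rw [e1, Real.mul_rpow hk.le e0]
          gcongr
        rw [Real.rpow_sub_one hk.ne']
        have e3 : ((k + 1 : ℕ) : ℝ) ^ u / u =
            ((k + 1 : ℕ) : ℝ) ^ u * (1 + u * (-1 / ((k + 1 : ℕ) : ℝ))) / u +
              ((k + 1 : ℕ) : ℝ) ^ u / ((k + 1 : ℕ) : ℝ) := by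
          field_simp
          ring
        rw [e3]
        gcongr
        exact ih.trans (by gcongr)
    refine (key N).trans ?_
    rw [mul_add, mul_one_div, mul_one_div]
    have : 0 ≤ (N : ℝ) ^ u / N := by positivity
    linarith
  · induction N, hN using Nat.le_induction with
    | base => simp; positivity
    | succ k hk1 ih =>
      rw [Finset.sum_Ioc_succ_top (Nat.zero_le _)]
      have hk0 : (0 : ℝ) < k := by exact_mod_cast hk1
      have hk : (0 : ℝ) < ((k + 1 : ℕ) : ℝ) := by positivity
      have hb := one_add_mul_self_le_rpow_one_add (s := 1 / (k : ℝ))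
        (le_trans (by norm_num) (one_div_pos.2 hk0).le) h1
      have e1 : ((k + 1 : ℕ) : ℝ) = k * (1 + 1 / (k : ℝ)) := by
        field_simp
        push_cast
        ring
      have e2 : (k : ℝ) ^ u * (1 + u * (1 / (k : ℝ))) ≤ ((k + 1 : ℕ) : ℝ) ^ u := by
        rw [e1, Real.mul_rpow hk0.le (by positivity)]
        gcongr
      rw [Real.rpow_sub_one hk.ne']
      have e3 : (k : ℝ) ^ u * (1 / k + 1 / u) = (k : ℝ) ^ u * (1 + u * (1 / (k : ℝ))) / u := by
        field_simp
        ring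
      have e4 : (k : ℝ) ^ u * (1 + u * (1 / (k : ℝ))) / u ≤ ((k + 1 : ℕ) : ℝ) ^ u / u := by
        gcongr
      have e5 : ((k + 1 : ℕ) : ℝ) ^ u * (1 / ((k + 1 : ℕ) : ℝ) + 1 / u) =
        ((k + 1 : ℕ) : ℝ) ^ u / ((k + 1 : ℕ) : ℝ) + ((k + 1 : ℕ) : ℝ) ^ u / u := by ring
      linarith

theorem sum_Ioc_rpow_neg_le {x : ℝ} (hx : 0 < x) {N M : ℕ} (hN : 1 ≤ N) (hNM : N ≤ M) :
    ∑ n ∈ Finset.Ioc N M, (n : ℝ) ^ (-(1 + x)) ≤ (N : ℝ) ^ (-x) / x := by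
  suffices h : ∑ n ∈ Finset.Ioc N M, (n : ℝ) ^ (-(1 + x)) ≤
      ((N : ℝ) ^ (-x) - (M : ℝ) ^ (-x)) / x by
    refine h.trans ?_
    gcongr
    have : 0 ≤ (M : ℝ) ^ (-x) := by positivity
    linarith
  induction M, hNM using Nat.le_induction with
  | base => simp
  | succ k hk ih =>
    rw [Finset.sum_Ioc_succ_top hk]
    have hk0 : (0 : ℝ) < k := by exact_mod_cast hN.trans hk
    have hk1 : (0 : ℝ) < ((k + 1 : ℕ) : ℝ) := by positivity
    have e1 : (k : ℝ) ^ (-x) = ((k + 1 : ℕ) : ℝ) ^ (-x) *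
        exp (x * -Real.log (k / ((k + 1 : ℕ) : ℝ))) := by
      rw [Real.log_div hk0.ne' hk1.ne', Real.rpow_def_of_pos hk0, Real.rpow_def_of_pos hk1,
        ← Real.exp_add]
      ring_nf
    have e2 := Real.log_le_sub_one_of_pos (div_pos hk0 hk1)
    have e3 : (k : ℝ) / ((k + 1 : ℕ) : ℝ) - 1 = -(1 / ((k + 1 : ℕ) : ℝ)) := by
      field_simp
      push_cast
      ring
    have e4 : 1 + x * (1 / ((k + 1 : ℕ) : ℝ)) ≤ exp (x * -Real.log (k / ((k + 1 : ℕ) : ℝ))) := by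
      have := Real.add_one_le_exp (x * -Real.log (k / ((k + 1 : ℕ) : ℝ)))
      have h2 : x * (1 / ((k + 1 : ℕ) : ℝ)) ≤ x * -Real.log (k / ((k + 1 : ℕ) : ℝ)) := by
        gcongr
        linarith
      linarith
    have e5 : ((k + 1 : ℕ) : ℝ) ^ (-x) * (1 + x * (1 / ((k + 1 : ℕ) : ℝ))) ≤ (k : ℝ) ^ (-x) := by
      rw [e1]
      gcongr
    have e6 : ((k + 1 : ℕ) : ℝ) ^ (-(1 + x)) =
        ((k + 1 : ℕ) : ℝ) ^ (-x) / ((k + 1 : ℕ) : ℝ) := by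
      rw [← Real.rpow_sub_one hk1.ne']
      ring_nf
    have e7 : ((k + 1 : ℕ) : ℝ) ^ (-x) / ((k + 1 : ℕ) : ℝ) ≤
        ((k : ℝ) ^ (-x) - ((k + 1 : ℕ) : ℝ) ^ (-x)) / x := by
      rw [le_div_iff₀ hx]
      have : ((k + 1 : ℕ) : ℝ) ^ (-x) / ((k + 1 : ℕ) : ℝ) * x =
        ((k + 1 : ℕ) : ℝ) ^ (-x) * (1 + x * (1 / ((k + 1 : ℕ) : ℝ))) -
          ((k + 1 : ℕ) : ℝ) ^ (-x) := by
        ring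
      linarith
    rw [e6]
    have : ((N : ℝ) ^ (-x) - ((k + 1 : ℕ) : ℝ) ^ (-x)) / x = ((N : ℝ) ^ (-x) - (k : ℝ) ^ (-x)) / x
      + ((k : ℝ) ^ (-x) - ((k + 1 : ℕ) : ℝ) ^ (-x)) / x := by ring
    linarith

theorem norm_LSeries_term_le {a : ℕ → ℂ} {C : ℝ} (ha : ∀ n, ‖a n‖ ≤ C) (z : ℂ) {n : ℕ}
    (hn : 0 < n) : ‖LSeries.term a (1 + z) n‖ ≤ C * (n : ℝ) ^ (-(1 + z.re)) := by
  rw [LSeries.norm_term_eq, if_neg hn.ne', Real.rpow_neg (Nat.cast_nonneg n), ← div_eq_mul_inv]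
  simp only [Complex.add_re, Complex.one_re]
  gcongr
  exact ha n

theorem norm_sum_LSeries_term_le {a : ℕ → ℂ} {C : ℝ} (ha : ∀ n, ‖a n‖ ≤ C) {z : ℂ}
    (hz : z.re < 0) {N : ℕ} (hN : 1 ≤ N) :
    ‖∑ n ∈ Finset.Ioc 0 N, LSeries.term a (1 + z) n‖ ≤
      C * ((N : ℝ) ^ (-z.re) * (1 / N + 1 / -z.re)) := by
  have hC : 0 ≤ C := (norm_nonneg _).trans (ha 0)
  refine (norm_sum_le _ _).trans ?_
  refine (Finset.sum_le_sum fun n hn =>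
    norm_LSeries_term_le ha z (Finset.mem_Ioc.1 hn).1).trans ?_
  rw [← Finset.mul_sum]
  refine mul_le_mul_of_nonneg_left ?_ hC
  rw [show -(1 + z.re) = -z.re - 1 by ring]
  exact sum_rpow_sub_one_le (u := -z.re) (by linarith) hN

theorem norm_sub_sum_LSeries_term_le {a : ℕ → ℂ} {C : ℝ} (ha : ∀ n, ‖a n‖ ≤ C) {z l : ℂ}
    (hz : 0 < z.re) (hl : LSeriesHasSum a (1 + z) l) {N : ℕ} (hN : 1 ≤ N) :
    ‖l - ∑ n ∈ Finset.Ioc 0 N, LSeries.term a (1 + z) n‖ ≤ C * ((N : ℝ) ^ (-z.re) / z.re) := by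
  have hC : 0 ≤ C := (norm_nonneg _).trans (ha 0)
  have ht : Tendsto (fun M : ℕ => ∑ n ∈ Finset.Ioc 0 M, LSeries.term a (1 + z) n) atTop
      (nhds l) := by
    have h1 := (hl.tendsto_sum_nat).comp (tendsto_add_atTop_nat 1)
    refine h1.congr fun M => ?_
    simp only [Function.comp_apply]
    rw [Finset.sum_range_eq_add_Ico _ (Nat.succ_pos M), LSeries.term_zero, zero_add]
    rfl
  refine le_of_tendsto ((ht.sub_const _).norm) ?_
  filter_upwards [eventually_ge_atTop N] with M hM
  rw [← Finset.sum_Ioc_consecutive _ (Nat.zero_le N) hM, add_sub_cancel_left]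
  refine (norm_sum_le _ _).trans ?_
  refine (Finset.sum_le_sum fun n hn =>
    norm_LSeries_term_le ha z ((Nat.zero_le N).trans_lt (Finset.mem_Ioc.1 hn).1)).trans ?_
  rw [← Finset.mul_sum]
  exact mul_le_mul_of_nonneg_left (sum_Ioc_rpow_neg_le hz hN hM) hC

theorem norm_one_add_sq_le {w : ℂ} (h1 : |w.re| ≤ 1) (h2 : |w.im| ≤ 1)
    (h : |w.re| = 1 ∨ |w.im| = 1) : ‖1 + w ^ 2‖ ≤ 4 * |w.re| := by
  refine (Complex.norm_le_abs_re_add_abs_im _).trans ?_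
  have e1 : (1 + w ^ 2).re = 1 + (|w.re| ^ 2 - |w.im| ^ 2) := by
    simp [sq]
  have e2 : |(1 + w ^ 2).im| = 2 * |w.re| * |w.im| := by
    have : (1 + w ^ 2).im = 2 * w.re * w.im := by simp [sq]; ring
    rw [this, abs_mul, abs_mul, abs_two]
  rw [e1, e2]
  have a1 := abs_nonneg w.re
  have a2 := abs_nonneg w.im
  generalize |w.re| = x at *
  generalize |w.im| = y at *
  have hnn : 0 ≤ 1 + (x ^ 2 - y ^ 2) := by nlinarith
  rw [abs_of_nonneg hnn]
  rcases h with rfl | rfl <;> nlinarith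

theorem one_le_norm_of_boundary {w : ℂ} (h : |w.re| = 1 ∨ |w.im| = 1) : 1 ≤ ‖w‖ := by
  rcases h with h | h
  · exact h ▸ Complex.abs_re_le_norm w
  · exact h ▸ Complex.abs_im_le_norm w

theorem norm_sum_div_le_of_LSeriesHasSum {a : ℕ → ℂ} {C : ℝ} (ha : ∀ n, ‖a n‖ ≤ C) {F : ℂ → ℂ}
    (hF : ∀ z : ℂ, 0 ≤ z.re → DifferentiableAt ℂ F z)
    (hsum : ∀ z : ℂ, 0 < z.re → LSeriesHasSum a (1 + z) (F z)) (hF0 : F 0 = 0)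
    {R : ℝ} (hR : 0 < R) {N : ℕ} (hN : 1 ≤ N) :
    2 * π * ‖∑ n ∈ Finset.Ioc 0 N, a n / n‖ ≤ 8 * (4 * C * (1 / N + 1 / R)) +
      ‖∫ y in (-1 : ℝ)..1, dslope (fun w : ℂ => F (R * w)) 0 (y * Complex.I) *
        ((N : ℂ) ^ (R * (y * Complex.I)) * (1 + (y * Complex.I) ^ 2))‖ := by
  have hC : 0 ≤ C := (norm_nonneg _).trans (ha 0)
  have hN0 : (N : ℂ) ≠ 0 := by exact_mod_cast (Nat.pos_of_ne_zero (by omega)).ne'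
  have hNpos : (0 : ℝ) < N := by exact_mod_cast hN
  set G : ℂ → ℂ := fun w => (∑ n ∈ Finset.Ioc 0 N, LSeries.term a (1 + R * w) n) *
    ((N : ℂ) ^ (R * w) * (1 + w ^ 2)) with hGdef
  set Q : ℂ → ℂ := dslope (fun w : ℂ => F (R * w)) 0 with hQ
  have hG0 : G 0 = ∑ n ∈ Finset.Ioc 0 N, a n / n := by
    simp only [hGdef, mul_zero, add_zero, Complex.cpow_zero, one_mul]
    rw [zero_pow two_ne_zero, add_zero, mul_one]
    refine Finset.sum_congr rfl fun n hn => ?_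
    rw [LSeries.term_of_ne_zero (Finset.mem_Ioc.1 hn).1.ne', Complex.cpow_one]
  have hGd : Differentiable ℂ G := by
    have h1 : Differentiable ℂ fun w : ℂ =>
        ∑ n ∈ Finset.Ioc 0 N, LSeries.term a (1 + R * w) n := by
      refine Differentiable.fun_sum fun n hn w => ?_
      exact DifferentiableAt.comp (g := fun z => LSeries.term a z n)
        (f := fun w : ℂ => 1 + R * w) w
        (LSeries.hasDerivAt_term a n (1 + R * w)).differentiableAt (by fun_prop)
    have h2 : Differentiable ℂ fun w : ℂ => (N : ℂ) ^ (R * w) := fun w =>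
      DifferentiableAt.const_cpow (by fun_prop) (Or.inl hN0)
    exact h1.mul (h2.mul (by fun_prop))
  have hk : Differentiable ℂ fun w : ℂ => (N : ℂ) ^ (R * w) * (1 + w ^ 2) := by
    have h2 : Differentiable ℂ fun w : ℂ => (N : ℂ) ^ (R * w) := fun w =>
      DifferentiableAt.const_cpow (by fun_prop) (Or.inl hN0)
    exact h2.mul (by fun_prop)
  have hFR : ∀ w : ℂ, 0 ≤ w.re → DifferentiableAt ℂ (fun w : ℂ => F (R * w)) w := fun w hw =>
    (hF (R * w) (by simpa using mul_nonneg hR.le hw)).comp w (by fun_prop)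
  have hQd : ∀ w : ℂ, 0 ≤ w.re → w ≠ 0 → DifferentiableAt ℂ Q w := fun w hw h0 =>
    (differentiableAt_dslope_of_ne h0).2 (hFR w hw)
  have hQc : ∀ w : ℂ, 0 ≤ w.re → ContinuousAt Q w := fun w hw => by
    by_cases h0 : w = 0
    · subst h0
      exact continuousAt_dslope_same.2 (hFR 0 (by simp))
    · exact (hQd w hw h0).continuousAt
  have hQval : ∀ w : ℂ, w ≠ 0 → Q w = F (R * w) / w := fun w h0 => by
    rw [hQ, dslope_of_ne _ h0, slope_def_field]
    simp [hF0]
  have hkn : ∀ w : ℂ, |w.re| ≤ 1 → |w.im| ≤ 1 → (|w.re| = 1 ∨ |w.im| = 1) →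
      ‖(N : ℂ) ^ (R * w) * (1 + w ^ 2) / w‖ ≤ (N : ℝ) ^ (R * w.re) * (4 * |w.re|) := by
    intro w h1 h2 h3
    rw [norm_div, norm_mul, Complex.norm_natCast_cpow_of_pos hN]
    refine (div_le_self (by positivity) (one_le_norm_of_boundary h3)).trans ?_
    rw [Complex.re_ofReal_mul]
    gcongr
    exact norm_one_add_sq_le h1 h2 h3
  rw [← hG0]
  refine norm_apply_zero_le_of_boundary_square (G := G)
    (P := fun w => Q w * ((N : ℂ) ^ (R * w) * (1 + w ^ 2))) hGd ?_ ?_ ?_ ?_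
  · intro w hw
    exact ((hQc w hw.1.1).mul hk.continuous.continuousAt).continuousWithinAt
  · intro w hw
    have hw1 : 0 < w.re := hw.1.1
    have hw0 : w ≠ 0 := fun h => by simp [h] at hw1
    exact ((hQd w hw1.le hw0).mul (hk w)).differentiableWithinAt
  · intro w hw h1 h2 h3
    have h3' : |w.re| = 1 ∨ |w.im| = 1 := h3.imp_left fun h => by simp [h]
    have hb := norm_sum_LSeries_term_le ha (z := R * w)
      (by simpa using mul_neg_of_pos_of_neg hR hw) hN
    have hb2 := hkn w h1 h2 h3'
    rw [Complex.re_ofReal_mul] at hb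
    rw [hGdef]
    simp only
    rw [mul_div_assoc, norm_mul]
    refine (mul_le_mul hb hb2 (norm_nonneg _) ?_).trans ?_
    · exact (norm_nonneg _).trans hb
    rw [abs_of_neg hw, Real.rpow_neg hNpos.le]
    have hp : 0 < (N : ℝ) ^ (R * w.re) := by positivity
    have hx : 0 < -w.re := by linarith
    have : C * (((N : ℝ) ^ (R * w.re))⁻¹ * (1 / N + 1 / -(R * w.re))) *
        ((N : ℝ) ^ (R * w.re) * (4 * -w.re)) = 4 * C * ((-w.re) * (1 / N) + 1 / R) := by
      have hw' := hw.ne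
      field_simp
      ring
    rw [this]
    rw [abs_of_neg hw] at h1
    have : -w.re * (1 / N : ℝ) ≤ 1 / N := mul_le_of_le_one_left (by positivity) h1
    gcongr
  · intro w hw h1 h2 h3
    have h3' : |w.re| = 1 ∨ |w.im| = 1 := h3.imp_left fun h => by simp [h]
    have hw0 : w ≠ 0 := fun h => by simp [h] at hw
    have hRw : 0 < ((R : ℂ) * w).re := by simpa using mul_pos hR hw
    have hb := norm_sub_sum_LSeries_term_le ha hRw (hsum _ hRw) hN
    have hb2 := hkn w h1 h2 h3'
    rw [Complex.re_ofReal_mul] at hb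
    have : Q w * ((N : ℂ) ^ (R * w) * (1 + w ^ 2)) - G w / w =
        (F (R * w) - ∑ n ∈ Finset.Ioc 0 N, LSeries.term a (1 + R * w) n) *
          ((N : ℂ) ^ (R * w) * (1 + w ^ 2) / w) := by
      rw [hQval w hw0, hGdef]
      ring
    rw [this, norm_mul]
    refine (mul_le_mul hb hb2 (norm_nonneg _) ?_).trans ?_
    · exact (norm_nonneg _).trans hb
    rw [abs_of_pos hw, Real.rpow_neg hNpos.le]
    have hp : 0 < (N : ℝ) ^ (R * w.re) := by positivity
    have : C * (((N : ℝ) ^ (R * w.re))⁻¹ / (R * w.re)) *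
        ((N : ℝ) ^ (R * w.re) * (4 * w.re)) = 4 * C * (1 / R) := by
      field_simp
    rw [this]
    have : (0 : ℝ) ≤ 1 / N := by positivity
    gcongr
    linarith

theorem tendsto_integral_mul_natCast_cpow {Q : ℝ → ℂ} {R : ℝ} (hR : 0 < R) :
    Tendsto (fun N : ℕ => ∫ y in (-1 : ℝ)..1, Q y *
        ((N : ℂ) ^ (R * (y * Complex.I)) * (1 + (y * Complex.I) ^ 2))) atTop (nhds 0) := by
  have hRL := Real.tendsto_integral_exp_smul_cocompact
    ((Set.Ioc (-1 : ℝ) 1).indicator fun y : ℝ => Q y * (1 + (y * Complex.I) ^ 2))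
  have hw : Tendsto (fun N : ℕ => -(R / (2 * π)) * Real.log N) atTop (cocompact ℝ) := by
    refine Tendsto.mono_right ?_ atBot_le_cocompact
    exact (Real.tendsto_log_atTop.comp tendsto_natCast_atTop_atTop).const_mul_atTop_of_neg
      (neg_neg_of_pos (by positivity))
  refine (hRL.comp hw).congr' ?_
  filter_upwards [eventually_ge_atTop 1] with N hN
  have hN0 : (N : ℂ) ≠ 0 := by exact_mod_cast (Nat.pos_of_ne_zero (by omega)).ne'
  rw [intervalIntegral.integral_of_le (by norm_num), ← MeasureTheory.integral_indicator
    measurableSet_Ioc]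
  simp only [Function.comp_apply]
  congr 1
  ext y
  by_cases hy : y ∈ Set.Ioc (-1 : ℝ) 1
  · rw [Set.indicator_of_mem hy, Set.indicator_of_mem hy, Circle.smul_def, Real.fourierChar_apply,
      smul_eq_mul, Complex.cpow_def_of_ne_zero hN0, ← Complex.natCast_log]
    have : 2 * (π : ℂ) * ((-(y * (-(R / (2 * π)) * Real.log N)) : ℝ) : ℂ) * Complex.I =
        Real.log N * (R * (y * Complex.I)) := by
      push_cast
      have : (π : ℂ) ≠ 0 := by exact_mod_cast pi_ne_zero
      field_simp
    push_cast at this ⊢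
    rw [this]
    ring
  · rw [Set.indicator_of_notMem hy, Set.indicator_of_notMem hy, smul_zero]

theorem tendsto_sum_div_of_LSeriesHasSum_of_eq_zero {a : ℕ → ℂ} {C : ℝ} (ha : ∀ n, ‖a n‖ ≤ C)
    {F : ℂ → ℂ} (hF : ∀ z : ℂ, 0 ≤ z.re → DifferentiableAt ℂ F z)
    (hsum : ∀ z : ℂ, 0 < z.re → LSeriesHasSum a (1 + z) (F z)) (hF0 : F 0 = 0) :
    Tendsto (fun N : ℕ => ∑ n ∈ Finset.Ioc 0 N, a n / n) atTop (nhds 0) := by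
  have hC : 0 ≤ C := (norm_nonneg _).trans (ha 0)
  rw [Metric.tendsto_atTop']
  intro ε hε
  obtain ⟨R, hR, hRε⟩ : ∃ R : ℝ, 0 < R ∧ 8 * (4 * C * (0 + 1 / R)) + 0 < ε := by
    refine ⟨(32 * C + 1) / ε, by positivity, ?_⟩
    rw [one_div_div]
    have : 8 * (4 * C * (0 + ε / (32 * C + 1))) + 0 = ε * (32 * C / (32 * C + 1)) := by
      ring
    rw [this]
    refine mul_lt_of_lt_one_right hε ?_
    rw [div_lt_one (by positivity)]
    linarith
  have hlim : Tendsto (fun N : ℕ => 8 * (4 * C * (1 / (N : ℝ) + 1 / R)) +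
      ‖∫ y in (-1 : ℝ)..1, dslope (fun w : ℂ => F (R * w)) 0 (y * Complex.I) *
        ((N : ℂ) ^ (R * (y * Complex.I)) * (1 + (y * Complex.I) ^ 2))‖) atTop
      (nhds (8 * (4 * C * (0 + 1 / R)) + 0)) := by
    refine Tendsto.add ?_ ?_
    · exact ((tendsto_one_div_atTop_nhds_zero_nat.add_const _).const_mul _).const_mul _
    · simpa using (tendsto_integral_mul_natCast_cpow
        (Q := fun y : ℝ => dslope (fun w : ℂ => F (R * w)) 0 (y * Complex.I)) hR).norm
  obtain ⟨N₀, hN₀⟩ := eventually_atTop.1 ((hlim.eventually (gt_mem_nhds hRε)).and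
    (eventually_ge_atTop 1))
  refine ⟨N₀, fun N hN => ?_⟩
  obtain ⟨h1, h2⟩ := hN₀ N hN.le
  have h3 := norm_sum_div_le_of_LSeriesHasSum ha hF hsum hF0 hR h2
  rw [dist_zero_right]
  have h4 : ‖∑ n ∈ Finset.Ioc 0 N, a n / n‖ ≤ 2 * π * ‖∑ n ∈ Finset.Ioc 0 N, a n / (n : ℂ)‖ :=
    le_mul_of_one_le_left (norm_nonneg _) (by linarith [pi_gt_three])
  linarith

/-- Newman's Tauberian theorem: a Dirichlet series with bounded coefficients converges at a point
of the line `re s = 1` if its sum extends holomorphically to that closed half-plane. -/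
theorem tendsto_sum_div_of_LSeriesHasSum {a : ℕ → ℂ} {C : ℝ} (ha : ∀ n, ‖a n‖ ≤ C)
    {F : ℂ → ℂ} (hF : ∀ z : ℂ, 0 ≤ z.re → DifferentiableAt ℂ F z)
    (hsum : ∀ z : ℂ, 0 < z.re → LSeriesHasSum a (1 + z) (F z)) :
    Tendsto (fun N : ℕ => ∑ n ∈ Finset.Ioc 0 N, a n / n) atTop (nhds (F 0)) := by
  have h := tendsto_sum_div_of_LSeriesHasSum_of_eq_zero
    (a := a - (fun n => F 0 * LSeries.delta n)) (C := C + ‖F 0‖) (F := fun z => F z - F 0) ?_ ?_ ?_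
    (sub_self _)
  · have h2 := h.add_const (F 0)
    rw [zero_add] at h2
    refine h2.congr' ?_
    filter_upwards [eventually_ge_atTop 1] with N hN
    have : ∑ n ∈ Finset.Ioc 0 N, F 0 * LSeries.delta n / (n : ℂ) = F 0 := by
      rw [Finset.sum_eq_single 1]
      · simp [LSeries.delta]
      · intro n _ hn
        simp [LSeries.delta, hn]
      · intro h
        exact absurd (Finset.mem_Ioc.2 ⟨one_pos, hN⟩) h
    simp only [Pi.sub_apply, sub_div, Finset.sum_sub_distrib, this]
    ring
  · intro n
    refine (norm_sub_le _ _).trans (add_le_add (ha n) ?_)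
    by_cases hn : n = 1 <;> simp [LSeries.delta, hn]
  · intro z hz
    exact (hF z hz).sub_const _
  · intro z hz
    refine (hsum z hz).sub ?_
    have h1 : LSeries.term (fun n => F 0 * LSeries.delta n) (1 + z) =
        fun n => if n = 1 then F 0 else 0 := by
      ext n
      by_cases hn : n = 1
      · subst hn
        simp [LSeries.term, LSeries.delta]
      · simp [LSeries.term, LSeries.delta, hn]
    rw [LSeriesHasSum, h1]
    exact hasSum_ite_eq 1 (F 0)

theorem sum_Ioc_inv_sqrt_le (M : ℕ) : ∑ n ∈ Finset.Ioc 0 M, 1 / √(n : ℝ) ≤ 2 * √(M : ℝ) := by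
  induction M with
  | zero => simp
  | succ M ih =>
    rw [Finset.sum_Ioc_succ_top (Nat.zero_le M)]
    have h0 : 0 < √((M + 1 : ℕ) : ℝ) := Real.sqrt_pos.2 (by positivity)
    have h1 : √((M + 1 : ℕ) : ℝ) ^ 2 = M + 1 := by
      rw [Real.sq_sqrt (by positivity)]
      push_cast
      ring
    have h2 : √(M : ℝ) ^ 2 = M := Real.sq_sqrt (by positivity)
    have h3 : 1 / √((M + 1 : ℕ) : ℝ) ≤ 2 * (√((M + 1 : ℕ) : ℝ) - √(M : ℝ)) := by
      rw [div_le_iff₀ h0]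
      nlinarith [sq_nonneg (√((M + 1 : ℕ) : ℝ) - √(M : ℝ))]
    linarith

theorem tendsto_sum_Ioc_div_mul {f e : ℕ → ℝ} {F : ℝ}
    (hF : Tendsto (fun N : ℕ => ∑ n ∈ Finset.Ioc 0 N, f n) atTop (nhds F)) (K : ℕ) :
    Tendsto (fun N : ℕ => ∑ n ∈ Finset.Ioc (N / (K + 1)) N, f n * e (N / n)) atTop (nhds 0) := by
  induction K with
  | zero => simp
  | succ K ih =>
    have hdiv : ∀ k : ℕ, Tendsto (fun N : ℕ => N / (k + 1)) atTop atTop := fun k =>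
      Nat.tendsto_div_const_atTop (Nat.succ_ne_zero k)
    have h1 := (((hF.comp (hdiv K)).sub (hF.comp (hdiv (K + 1)))).mul_const (e (K + 1))).add ih
    rw [sub_self, zero_mul, zero_add] at h1
    refine h1.congr fun N => ?_
    have hle : N / (K + 1 + 1) ≤ N / (K + 1) := Nat.div_le_div_left (by omega) (by omega)
    rw [← Finset.sum_Ioc_consecutive (fun n => f n * e (N / n)) hle (Nat.div_le_self _ _)]
    congr 1
    simp only [Function.comp_apply]
    rw [← Finset.sum_Ioc_consecutive f (Nat.zero_le _) hle, add_sub_cancel_left, Finset.sum_mul]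
    refine Finset.sum_congr rfl fun n hn => ?_
    obtain ⟨ha, hb⟩ := Finset.mem_Ioc.1 hn
    have hn0 : 0 < n := (Nat.zero_le _).trans_lt ha
    have : N / n = K + 1 := by
      refine Nat.div_eq_of_lt_le ?_ ?_
      · rw [Nat.le_div_iff_mul_le (by omega)] at hb
        linarith [mul_comm n (K + 1)]
      · rw [Nat.div_lt_iff_lt_mul (by omega)] at ha
        linarith [mul_comm n (K + 1 + 1)]
    rw [this]

theorem abs_sum_Ioc_mul_le {f e : ℕ → ℝ} {C C' : ℝ} (hC : ∀ n : ℕ, |f n| ≤ C / n)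
    (hC' : ∀ n : ℕ, 1 ≤ n → |e n| ≤ C' / √(n : ℝ)) {K N : ℕ} (hN : 1 ≤ N) :
    |∑ n ∈ Finset.Ioc 0 (N / (K + 1)), f n * e (N / n)| ≤ C * C' * √2 * 2 / √(K + 1 : ℝ) := by
  have hC0 : 0 ≤ C := by simpa using (abs_nonneg _).trans (hC 1)
  have hC0' : 0 ≤ C' := by simpa using (abs_nonneg _).trans (hC' 1 le_rfl)
  have hNpos : (0 : ℝ) < N := by exact_mod_cast hN
  have hsN : 0 < √(N : ℝ) := Real.sqrt_pos.2 hNpos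
  have hsK : 0 < √(K + 1 : ℝ) := Real.sqrt_pos.2 (by positivity)
  have key : ∀ n ∈ Finset.Ioc 0 (N / (K + 1)),
      |f n * e (N / n)| ≤ C * C' * √2 / √(N : ℝ) * (1 / √(n : ℝ)) := by
    intro n hn
    obtain ⟨ha, hb⟩ := Finset.mem_Ioc.1 hn
    have hnN : n ≤ N := hb.trans (Nat.div_le_self _ _)
    have hq : 1 ≤ N / n := Nat.div_pos hnN ha
    have hlt : N ≤ 2 * n * (N / n) := by
      have := Nat.lt_mul_div_succ N ha
      nlinarith
    have hn0 : (0 : ℝ) < n := by exact_mod_cast ha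
    have hq0 : (0 : ℝ) < (N / n : ℕ) := by exact_mod_cast hq
    have hs : √(N : ℝ) ≤ √2 * √(n : ℝ) * √((N / n : ℕ) : ℝ) := by
      rw [← Real.sqrt_mul (by positivity), ← Real.sqrt_mul (by positivity)]
      exact Real.sqrt_le_sqrt (by exact_mod_cast hlt)
    have hsn : 0 < √(n : ℝ) := Real.sqrt_pos.2 hn0
    have hsq : 0 < √((N / n : ℕ) : ℝ) := Real.sqrt_pos.2 hq0
    rw [abs_mul]
    refine (mul_le_mul (hC n) (hC' _ hq) (abs_nonneg _) (by positivity)).trans ?_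
    have h1 : C' / √((N / n : ℕ) : ℝ) ≤ C' * (√2 * √(n : ℝ) / √(N : ℝ)) := by
      rw [div_eq_mul_inv]
      gcongr
      rw [inv_eq_one_div, div_le_div_iff₀ hsq hsN]
      linarith
    calc C / n * (C' / √((N / n : ℕ) : ℝ)) ≤ C / n * (C' * (√2 * √(n : ℝ) / √(N : ℝ))) := by
          gcongr
      _ = C * C' * √2 / √(N : ℝ) * (1 / √(n : ℝ)) := by
          have : (n : ℝ) = √(n : ℝ) * √(n : ℝ) := (Real.mul_self_sqrt hn0.le).symm
          rw [show C / (n : ℝ) = C / (√(n : ℝ) * √(n : ℝ)) by rw [← this]]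
          field_simp
  refine (Finset.abs_sum_le_sum_abs _ _).trans ((Finset.sum_le_sum key).trans ?_)
  rw [← Finset.mul_sum]
  refine (mul_le_mul_of_nonneg_left (sum_Ioc_inv_sqrt_le _) (by positivity)).trans ?_
  have h2 : √((N / (K + 1) : ℕ) : ℝ) ≤ √(N : ℝ) / √(K + 1 : ℝ) := by
    rw [← Real.sqrt_div hNpos.le]
    exact Real.sqrt_le_sqrt (by exact_mod_cast Nat.cast_div_le)
  calc C * C' * √2 / √(N : ℝ) * (2 * √((N / (K + 1) : ℕ) : ℝ))
      ≤ C * C' * √2 / √(N : ℝ) * (2 * (√(N : ℝ) / √(K + 1 : ℝ))) := by gcongr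
    _ = _ := by field_simp

/-- The Dirichlet convolution of a convergent series and a series converging at rate `N ^ (-1/2)`
converges to the product. -/
theorem tendsto_sum_Ioc_convolution {f g : ArithmeticFunction ℝ} {C C' F G : ℝ}
    (hC : ∀ n : ℕ, |f n| ≤ C / n)
    (hF : Tendsto (fun N : ℕ => ∑ n ∈ Finset.Ioc 0 N, f n) atTop (nhds F))
    (hG : ∀ N : ℕ, 1 ≤ N → |∑ n ∈ Finset.Ioc 0 N, g n - G| ≤ C' / √(N : ℝ)) :
    Tendsto (fun N : ℕ => ∑ n ∈ Finset.Ioc 0 N, (f * g) n) atTop (nhds (F * G)) := by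
  set e : ℕ → ℝ := fun N => ∑ n ∈ Finset.Ioc 0 N, g n - G with he
  have h0 : Tendsto (fun N : ℕ => ∑ n ∈ Finset.Ioc 0 N, f n * e (N / n)) atTop (nhds 0) := by
    rw [Metric.tendsto_atTop']
    intro ε hε
    have hlim : Tendsto (fun K : ℕ => C * C' * √2 * 2 / √(K + 1 : ℝ)) atTop (nhds 0) := by
      refine Tendsto.div_atTop tendsto_const_nhds ?_
      exact Real.tendsto_sqrt_atTop.comp
        (tendsto_natCast_atTop_atTop.atTop_add tendsto_const_nhds)
    obtain ⟨K, hK⟩ := (hlim.eventually (gt_mem_nhds (half_pos hε))).exists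
    obtain ⟨N₀, hN₀⟩ := eventually_atTop.1 (((tendsto_sum_Ioc_div_mul (e := e) hF K).eventually
      (Metric.ball_mem_nhds 0 (half_pos hε))).and (eventually_ge_atTop 1))
    refine ⟨N₀, fun N hN => ?_⟩
    obtain ⟨h1, h2⟩ := hN₀ N hN.le
    have h3 := abs_sum_Ioc_mul_le hC hG (K := K) h2
    rw [dist_zero_right, Real.norm_eq_abs] at h1
    rw [dist_zero_right, Real.norm_eq_abs, ← Finset.sum_Ioc_consecutive
      (fun n => f n * e (N / n)) (Nat.zero_le _) (Nat.div_le_self N (K + 1))]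
    refine (abs_add_le _ _).trans_lt ?_
    linarith
  have h1 := h0.add (hF.mul_const G)
  rw [zero_add] at h1
  refine h1.congr fun N => ?_
  rw [ArithmeticFunction.sum_Ioc_mul_eq_sum_sum, Finset.sum_mul, ← Finset.sum_add_distrib]
  refine Finset.sum_congr rfl fun n _ => ?_
  simp only [he]
  ring

theorem abs_sum_Ioc_mul_antitone_le {c w : ℕ → ℝ} {B : ℝ} {m : ℕ}
    (hc : ∀ N, |∑ n ∈ Finset.Ioc 0 N, c n| ≤ B) (hw : AntitoneOn w (Set.Ici m))
    (hw0 : ∀ n, 0 ≤ w n) {M N : ℕ} (hM : m ≤ M) (hMN : M ≤ N) :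
    |∑ n ∈ Finset.Ioc M N, c n * w n| ≤ 2 * B * w M := by
  have hB : 0 ≤ B := (abs_nonneg _).trans (hc 0)
  have hT : ∀ N, M ≤ N → |∑ n ∈ Finset.Ioc M N, c n| ≤ 2 * B := fun N hN => by
    have h := Finset.sum_Ioc_consecutive c (Nat.zero_le M) hN
    have h1 : ∑ n ∈ Finset.Ioc M N, c n =
        ∑ n ∈ Finset.Ioc 0 N, c n - ∑ n ∈ Finset.Ioc 0 M, c n := by linarith
    rw [h1]
    exact (abs_sub _ _).trans (by linarith [hc N, hc M])
  have key : |∑ n ∈ Finset.Ioc M N, c n * w n - (∑ n ∈ Finset.Ioc M N, c n) * w N| ≤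
      2 * B * (w M - w N) := by
    induction N, hMN using Nat.le_induction with
    | base => simp
    | succ N hMN ih =>
      have hanti : w (N + 1) ≤ w N :=
        hw (hM.trans hMN) (hM.trans (hMN.trans N.le_succ)) N.le_succ
      rw [Finset.sum_Ioc_succ_top hMN, Finset.sum_Ioc_succ_top hMN]
      have h1 : ∑ n ∈ Finset.Ioc M N, c n * w n + c (N + 1) * w (N + 1) -
          (∑ n ∈ Finset.Ioc M N, c n + c (N + 1)) * w (N + 1) =
          (∑ n ∈ Finset.Ioc M N, c n * w n - (∑ n ∈ Finset.Ioc M N, c n) * w N) +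
          (∑ n ∈ Finset.Ioc M N, c n) * (w N - w (N + 1)) := by ring
      rw [h1]
      refine (abs_add_le _ _).trans ?_
      rw [abs_mul, abs_of_nonneg (sub_nonneg.2 hanti)]
      have := mul_le_mul_of_nonneg_right (hT N hMN) (sub_nonneg.2 hanti)
      linarith
  have h2 : |(∑ n ∈ Finset.Ioc M N, c n) * w N| ≤ 2 * B * w N := by
    rw [abs_mul, abs_of_nonneg (hw0 N)]
    exact mul_le_mul_of_nonneg_right (hT N hMN) (hw0 N)
  have h3 := abs_add_le (∑ n ∈ Finset.Ioc M N, c n * w n - (∑ n ∈ Finset.Ioc M N, c n) * w N)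
    ((∑ n ∈ Finset.Ioc M N, c n) * w N)
  rw [sub_add_cancel] at h3
  linarith

/-- Dirichlet's test, with the rate of convergence. -/
theorem exists_abs_sum_Ioc_mul_sub_le {c w : ℕ → ℝ} {B K : ℝ} {m : ℕ}
    (hc : ∀ N, |∑ n ∈ Finset.Ioc 0 N, c n| ≤ B) (hw : AntitoneOn w (Set.Ici m))
    (hw0 : ∀ n, 0 ≤ w n) (hwK : ∀ n, w n ≤ K / √(n : ℝ)) :
    ∃ G C' : ℝ, Tendsto (fun N : ℕ => ∑ n ∈ Finset.Ioc 0 N, c n * w n) atTop (nhds G) ∧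
      ∀ N : ℕ, 1 ≤ N → |∑ n ∈ Finset.Ioc 0 N, c n * w n - G| ≤ C' / √(N : ℝ) := by
  have hB : 0 ≤ B := (abs_nonneg _).trans (hc 0)
  have hK : 0 ≤ K := by simpa using (hw0 1).trans (hwK 1)
  set S : ℕ → ℝ := fun N => ∑ n ∈ Finset.Ioc 0 N, c n * w n with hS
  have hdiff : ∀ M N : ℕ, m ≤ M → M ≤ N → |S N - S M| ≤ 2 * B * (K / √(M : ℝ)) := by
    intro M N hM hMN
    have h := Finset.sum_Ioc_consecutive (fun n => c n * w n) (Nat.zero_le M) hMN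
    have h1 : S N - S M = ∑ n ∈ Finset.Ioc M N, c n * w n := by
      simp only [hS]
      linarith
    rw [h1]
    refine (abs_sum_Ioc_mul_antitone_le hc hw hw0 hM hMN).trans ?_
    exact mul_le_mul_of_nonneg_left (hwK M) (by positivity)
  have hlim : Tendsto (fun M : ℕ => 2 * B * (K / √(M : ℝ))) atTop (nhds 0) := by
    rw [← mul_zero (2 * B)]
    refine Tendsto.const_mul _ (Tendsto.div_atTop tendsto_const_nhds ?_)
    exact Real.tendsto_sqrt_atTop.comp tendsto_natCast_atTop_atTop
  have hcau : CauchySeq S := by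
    rw [Metric.cauchySeq_iff']
    intro ε hε
    obtain ⟨M, h1, h2⟩ := ((hlim.eventually (gt_mem_nhds hε)).and (eventually_ge_atTop m)).exists
    refine ⟨M, fun N hN => ?_⟩
    rw [Real.dist_eq]
    exact (hdiff M N h2 hN).trans_lt h1
  obtain ⟨G, hG⟩ := cauchySeq_tendsto_of_complete hcau
  refine ⟨G, 2 * B * K + ∑ N ∈ Finset.Ioc 0 m, |S N - G| * √(N : ℝ), hG, fun N hN => ?_⟩
  have hs : 0 < √(N : ℝ) := Real.sqrt_pos.2 (by exact_mod_cast hN)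
  have hsum : 0 ≤ ∑ N ∈ Finset.Ioc 0 m, |S N - G| * √(N : ℝ) :=
    Finset.sum_nonneg fun _ _ => by positivity
  rw [le_div_iff₀ hs]
  rcases le_or_gt m N with h | h
  · have h1 : |G - S N| ≤ 2 * B * (K / √(N : ℝ)) :=
      le_of_tendsto (hG.sub_const (S N)).abs
        ((eventually_ge_atTop N).mono fun n hn => hdiff N n h hn)
    rw [abs_sub_comm] at h1
    have h2 := mul_le_mul_of_nonneg_right h1 hs.le
    have h3 : 2 * B * (K / √(N : ℝ)) * √(N : ℝ) = 2 * B * K := by field_simp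
    have h4 : |∑ n ∈ Finset.Ioc 0 N, c n * w n - G| = |S N - G| := rfl
    rw [h4]
    linarith
  · have h1 := Finset.single_le_sum (f := fun N : ℕ => |S N - G| * √(N : ℝ))
      (fun _ _ => by positivity) (Finset.mem_Ioc.2 ⟨hN, h.le⟩)
    have h2 : 0 ≤ 2 * B * K := by positivity
    exact h1.trans (le_add_of_nonneg_left h2)

theorem log_div_self_le_div_sqrt (n : ℕ) : Real.log n / n ≤ 2 / √(n : ℝ) := by
  rcases Nat.eq_zero_or_pos n with rfl | hn
  · simp
  have hn0 : (0 : ℝ) < n := by exact_mod_cast hn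
  have hs : 0 < √(n : ℝ) := Real.sqrt_pos.2 hn0
  have h1 : Real.log n ≤ 2 * √(n : ℝ) := by
    have h2 := Real.log_le_self hs.le
    rw [Real.log_sqrt hn0.le] at h2
    linarith
  rw [div_le_div_iff₀ hn0 hs]
  have h3 := mul_le_mul_of_nonneg_right h1 hs.le
  rw [mul_assoc, Real.mul_self_sqrt hn0.le] at h3
  exact h3

theorem exists_abs_sum_Ioc_div_sub_le {c : ℕ → ℝ} {B : ℝ}
    (hc : ∀ N, |∑ n ∈ Finset.Ioc 0 N, c n| ≤ B) :
    ∃ G C' : ℝ, Tendsto (fun N : ℕ => ∑ n ∈ Finset.Ioc 0 N, c n / n) atTop (nhds G) ∧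
      ∀ N : ℕ, 1 ≤ N → |∑ n ∈ Finset.Ioc 0 N, c n / n - G| ≤ C' / √(N : ℝ) := by
  have h := exists_abs_sum_Ioc_mul_sub_le (w := fun n : ℕ => (n : ℝ)⁻¹) (K := 1) (m := 1) hc
    ?_ (fun n => by positivity) ?_
  · simpa only [div_eq_mul_inv] using h
  · intro a ha b _ hab
    have ha' : (0 : ℝ) < a := by exact_mod_cast Nat.lt_of_succ_le ha
    exact inv_anti₀ ha' (by exact_mod_cast hab)
  · intro n
    rcases Nat.eq_zero_or_pos n with rfl | hn
    · simp
    have hn1 : (1 : ℝ) ≤ n := by exact_mod_cast hn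
    rw [one_div]
    refine inv_anti₀ (Real.sqrt_pos.2 (by linarith)) ?_
    exact Real.sqrt_le_iff.2 ⟨by linarith, by nlinarith⟩

theorem exists_abs_sum_Ioc_mul_log_div_sub_le {c : ℕ → ℝ} {B : ℝ}
    (hc : ∀ N, |∑ n ∈ Finset.Ioc 0 N, c n| ≤ B) :
    ∃ G C' : ℝ,
      Tendsto (fun N : ℕ => ∑ n ∈ Finset.Ioc 0 N, c n * Real.log n / n) atTop (nhds G) ∧
      ∀ N : ℕ, 1 ≤ N → |∑ n ∈ Finset.Ioc 0 N, c n * Real.log n / n - G| ≤ C' / √(N : ℝ) := by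
  have h := exists_abs_sum_Ioc_mul_sub_le (w := fun n : ℕ => Real.log n / n) (K := 2) (m := 3) hc
    ?_ (fun n => by positivity) log_div_self_le_div_sqrt
  · simpa only [mul_div_assoc] using h
  · intro a ha b hb hab
    have h3 : ∀ x ∈ Set.Ici 3, Real.exp 1 ≤ ((x : ℕ) : ℝ) := fun x hx => by
      have : (3 : ℝ) ≤ x := by exact_mod_cast hx
      linarith [Real.exp_one_lt_d9]
    exact Real.log_div_self_antitoneOn (h3 a ha) (h3 b hb) (by exact_mod_cast hab)

open scoped NumberTheorySymbols in
theorem jacobiSym_neg_natCast_eq_of_prime {b p : ℕ} (hb : b % 4 = 3) (hp : p.Prime) :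
    J(p | b) = kron (-b) p := by
  have hbo : Odd b := Nat.odd_iff.2 (by omega)
  have : NeZero b := ⟨by omega⟩
  unfold kron
  split_ifs with h1 h2 h3
  · rw [jacobiSym.eq_zero_iff_not_coprime, Int.gcd_natCast_natCast]
    rw [Int.dvd_neg, Int.natCast_dvd_natCast] at h1
    rw [Nat.gcd_eq_left h1]
    exact hp.one_lt.ne'
  · subst h2
    rw [Nat.cast_ofNat, jacobiSym.at_two hbo, ZMod.χ₈_nat_eq_if_mod_eight, if_neg (by omega),
      if_pos (by omega)]
  · subst h2
    rw [Nat.cast_ofNat, jacobiSym.at_two hbo, ZMod.χ₈_nat_eq_if_mod_eight, if_neg (by omega),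
      if_neg (by omega)]
  · have hpo : Odd p := hp.odd_of_ne_two h2
    rw [jacobiSym.neg _ hpo]
    rcases Nat.odd_mod_four_iff.1 (Nat.odd_iff.1 hpo) with h | h
    · rw [ZMod.χ₄_nat_one_mod_four h, one_mul, jacobiSym.quadratic_reciprocity_one_mod_four h hbo]
    · rw [ZMod.χ₄_nat_three_mod_four h, jacobiSym.quadratic_reciprocity_three_mod_four h hb]
      ring

open scoped NumberTheorySymbols in
theorem jacobiSym_eq_kron_four_mul {m : ℤ} {p : ℕ} (hp : p.Prime) :
    (if Even p then 0 else J(m | p)) = kron (4 * m) p := by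
  have : NeZero p := ⟨hp.ne_zero⟩
  unfold kron
  by_cases hpe : Even p
  · rw [if_pos hpe, hp.even_iff.1 hpe, if_pos]
    exact ⟨2 * m, by push_cast; ring⟩
  · have hpo : Odd p := Nat.not_even_iff_odd.1 hpe
    have h2 : p ≠ 2 := fun h => hpe (h ▸ even_two)
    rw [if_neg hpe, if_neg h2, jacobiSym.mul_left, jacobiSym.at_four hpo, one_mul]
    split_ifs with h
    · rw [jacobiSym.eq_zero_iff_not_coprime]
      have hpm : (p : ℤ) ∣ m := by
        refine (Nat.prime_iff_prime_int.1 hp).dvd_or_dvd h |>.resolve_left fun h4 => h2 ?_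
        have h5 : p ∣ 2 ^ 2 := by exact_mod_cast h4
        exact (Nat.prime_dvd_prime_iff_eq hp Nat.prime_two).1 (hp.dvd_of_dvd_pow h5)
      rw [show m.gcd p = p from Nat.gcd_eq_right (Int.natCast_dvd.1 hpm)]
      exact hp.one_lt.ne'
    · rfl

open scoped NumberTheorySymbols in
theorem jacobiSym_neg_natCast_eq_neg_one {k n : ℕ} (hk : k % 4 = 1 ∨ k % 4 = 2)
    (hn : n + 1 = 4 * k) :
    J(-(k : ℤ) | n) = -1 := by
  have hn4 : n % 4 = 3 := by omega
  have hno : Odd n := Nat.odd_iff.2 (by omega)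
  have key : ∀ j : ℕ, Odd j → j ∣ k → J(j | n) = 1 := by
    intro j hj hjk
    have hnj : J(n | j) = ZMod.χ₄ j := by
      rw [← jacobiSym.at_neg_one hj]
      refine jacobiSym.mod_left' (Int.ModEq.symm ((Int.modEq_iff_dvd).2 ?_))
      obtain ⟨l, rfl⟩ := hjk
      have hn' : (n : ℤ) + 1 = 4 * (j * l) := by exact_mod_cast hn
      exact ⟨4 * l, by linarith⟩
    rcases Nat.odd_mod_four_iff.1 (Nat.odd_iff.1 hj) with h | h
    · rw [jacobiSym.quadratic_reciprocity_one_mod_four h hno, hnj, ZMod.χ₄_nat_one_mod_four h]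
    · rw [jacobiSym.quadratic_reciprocity_three_mod_four h hn4, hnj, ZMod.χ₄_nat_three_mod_four h]
      rfl
  rw [jacobiSym.neg _ hno, ZMod.χ₄_nat_three_mod_four hn4]
  rcases hk with hk | hk
  · rw [key k (Nat.odd_iff.2 (by omega)) dvd_rfl]
    rfl
  · obtain ⟨j, rfl⟩ : ∃ j, k = 2 * j := ⟨k / 2, by omega⟩
    rw [Nat.cast_mul, jacobiSym.mul_left, key j (Nat.odd_iff.2 (by omega)) (dvd_mul_left _ _),
      Nat.cast_ofNat, jacobiSym.at_two hno, ZMod.χ₈_nat_eq_if_mod_eight, if_neg (by omega),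
      if_pos (by omega)]
    rfl

theorem eq_of_forall_prime_eq {f g : ℕ → ℤ} (h0 : f 0 = g 0) (h1 : f 1 = g 1)
    (hf : ∀ m n, f (m * n) = f m * f n) (hg : ∀ m n, g (m * n) = g m * g n)
    (hp : ∀ p, p.Prime → f p = g p) : f = g := by
  ext n
  induction n using Nat.recOnMul with
  | zero => exact h0
  | one => exact h1
  | prime p h => exact hp p h
  | mul a b ha hb => rw [hf, hg, ha, hb]

open scoped NumberTheorySymbols in
theorem IsChiD.mod_natAbs {D : ℤ} {χ : ℕ → ℤ} (hχ : IsChiD D χ) (hD : D ≤ -3)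
    (hfund : IsFundamentalDiscriminant D) :
    (∀ n, χ (n % D.natAbs) = χ n) ∧ ∃ n, χ n = -1 := by
  obtain ⟨h0, h1, hmul, hp⟩ := hχ
  rcases hfund with ⟨hD4, -⟩ | ⟨m, rfl, -, hm⟩
  · obtain ⟨b, rfl⟩ : ∃ b : ℕ, D = -b := ⟨D.natAbs, by omega⟩
    have hb : b % 4 = 3 := by omega
    have hχJ : χ = fun n : ℕ => J(n | b) := by
      refine eq_of_forall_prime_eq ?_ ?_ hmul (fun m n => ?_) fun p h => ?_
      · rw [h0, Nat.cast_zero, jacobiSym.zero_left (by omega)]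
      · rw [h1, Nat.cast_one, jacobiSym.one_left]
      · rw [Nat.cast_mul, jacobiSym.mul_left]
      · rw [hp p h, jacobiSym_neg_natCast_eq_of_prime hb h]
    have hbo : Odd b := Nat.odd_iff.2 (by omega)
    rw [hχJ, Int.natAbs_neg, Int.natAbs_natCast]
    refine ⟨fun n => ?_, b - 1, ?_⟩
    · simp only
      rw [Int.natCast_mod, ← jacobiSym.mod_left]
    · simp only
      rw [← ZMod.χ₄_nat_three_mod_four hb, ← jacobiSym.at_neg_one hbo, Nat.cast_sub (by omega)]
      refine jacobiSym.mod_left' (Int.modEq_iff_dvd.2 ⟨-1, ?_⟩)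
      push_cast
      ring
  · have hχJ : χ = fun n : ℕ => if Even n then 0 else J(m | n) := by
      refine eq_of_forall_prime_eq ?_ ?_ hmul (fun k n => ?_) fun p h => ?_
      · rw [h0, if_pos Even.zero]
      · rw [h1, if_neg Nat.not_even_one, jacobiSym.one_right]
      · by_cases hk : Even k
        · rw [if_pos hk, if_pos (hk.mul_right n), zero_mul]
        by_cases hn : Even n
        · rw [if_pos hn, if_pos (hn.mul_left k), mul_zero]
        have hkn : ¬ Even (k * n) := by
          rw [Nat.even_mul]
          tauto
        rw [if_neg hk, if_neg hn, if_neg hkn, jacobiSym.mul_right']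
        · rintro rfl
          exact hk Even.zero
        · rintro rfl
          exact hn Even.zero
      · rw [hp p h, jacobiSym_eq_kron_four_mul h]
    have hN : (4 * m).natAbs = 4 * m.natAbs := by rw [Int.natAbs_mul]; rfl
    rw [hχJ, hN]
    refine ⟨fun n => ?_, 4 * m.natAbs - 1, ?_⟩
    · have hpar : Even (n % (4 * m.natAbs)) ↔ Even n := by
        rw [Nat.even_iff, Nat.even_iff, Nat.mod_mod_of_dvd _ ⟨2 * m.natAbs, by ring⟩]
      simp only [hpar]
      split_ifs with h
      · rfl
      · rw [← jacobiSym.mod_right _ (Nat.not_even_iff_odd.1 h)]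
    · have hmneg : m = -(m.natAbs : ℤ) := by omega
      have hodd : ¬ Even (4 * m.natAbs - 1) := by
        rw [Nat.even_iff]
        omega
      simp only [if_neg hodd]
      nth_rw 1 [hmneg]
      exact jacobiSym_neg_natCast_eq_neg_one (by omega) (by omega)

theorem exists_dirichletCharacter_eq {N : ℕ} [NeZero N] {χ : ℕ → ℤ} (h1 : χ 1 = 1)
    (hmul : ∀ m n, χ (m * n) = χ m * χ n) (hmod : ∀ n, χ (n % N) = χ n)
    (hcop : ∀ n, ¬ n.Coprime N → χ n = 0) :
    ∃ ψ : DirichletCharacter ℂ N, ∀ n : ℕ, ψ n = χ n := by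
  refine ⟨{ toFun := fun a => χ a.val, map_one' := ?_, map_mul' := ?_, map_nonunit' := ?_ }, ?_⟩
  · rw [ZMod.val_one_eq_one_mod, hmod, h1, Int.cast_one]
  · intro a b
    rw [ZMod.val_mul, hmod, hmul, Int.cast_mul]
  · intro a ha
    simp only [Int.cast_eq_zero]
    refine hcop _ fun h => ha ?_
    have := (ZMod.isUnit_iff_coprime a.val N).2 h
    rwa [ZMod.natCast_zmod_val] at this
  · intro n
    change ((χ (n : ZMod N).val : ℤ) : ℂ) = χ n
    rw [ZMod.val_natCast, hmod]

theorem IsChiD.exists_dirichletCharacter {D : ℤ} {χ : ℕ → ℤ} (hχ : IsChiD D χ) (hD : D ≤ -3)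
    (hfund : IsFundamentalDiscriminant D) : ∃ N : ℕ, N ≠ 0 ∧
    ∃ ψ : DirichletCharacter ℂ N, ψ ≠ 1 ∧ ∀ n : ℕ, ψ n = χ n := by
  obtain ⟨hmod, n, hn⟩ := hχ.mod_natAbs hD hfund
  have : NeZero D.natAbs := ⟨by omega⟩
  have hcop : ∀ n : ℕ, ¬ n.Coprime D.natAbs → χ n = 0 := by
    intro n hn
    obtain ⟨p, hp, h1, h2⟩ := Nat.Prime.not_coprime_iff_dvd.1 hn
    obtain ⟨k, rfl⟩ := h1
    rw [hχ.2.2.1, hχ.2.2.2 p hp, kron, if_pos (Int.natCast_dvd.2 h2), zero_mul]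
  obtain ⟨ψ, hψ⟩ := exists_dirichletCharacter_eq hχ.2.1 hχ.2.2.1 hmod hcop
  refine ⟨D.natAbs, NeZero.ne _, ψ, ?_, hψ⟩
  rintro rfl
  have h := hψ n
  have hu : IsUnit (n : ZMod D.natAbs) := by
    by_contra hu
    rw [hn, MulChar.map_nonunit _ hu] at h
    norm_num at h
  rw [hn, MulChar.one_apply hu] at h
  norm_num at h

theorem sum_range_succ_eq_add_sum_Ioc {M : Type*} [AddCommMonoid M] (f : ℕ → M) (N : ℕ) :
    ∑ n ∈ Finset.range (N + 1), f n = f 0 + ∑ n ∈ Finset.Ioc 0 N, f n := by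
  induction N with
  | zero => simp
  | succ N ih =>
    rw [Finset.sum_range_succ, ih, Finset.sum_Ioc_succ_top (Nat.zero_le N), add_assoc]

theorem ZMod.sum_range_natCast {M : Type*} [AddCommMonoid M] {N : ℕ} [NeZero N]
    (f : ZMod N → M) : ∑ i ∈ Finset.range N, f i = ∑ a, f a := by
  refine Finset.sum_bij' (fun i _ => (i : ZMod N)) (fun a _ => a.val) (fun _ _ => Finset.mem_univ _)
    (fun a _ => Finset.mem_range.2 a.val_lt) (fun i hi => ?_) (fun a _ => ?_) (fun _ _ => rfl)
  · exact ZMod.val_cast_of_lt (Finset.mem_range.1 hi)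
  · exact ZMod.natCast_zmod_val a

theorem DirichletCharacter.norm_sum_range_le {N : ℕ} [NeZero N] {ψ : DirichletCharacter ℂ N}
    (hψ : ψ ≠ 1) (M : ℕ) : ‖∑ n ∈ Finset.range M, ψ n‖ ≤ N := by
  have hper : ∀ M, ∑ n ∈ Finset.range (M + N), ψ n = ∑ n ∈ Finset.range M, ψ n := by
    intro M
    rw [Finset.sum_range_add]
    have h : ∑ i ∈ Finset.range N, ψ ((M + i : ℕ) : ZMod N) = 0 := by
      simp only [Nat.cast_add]
      rw [ZMod.sum_range_natCast fun a : ZMod N => ψ ((M : ZMod N) + a)]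
      exact (Equiv.sum_comp (Equiv.addLeft (M : ZMod N)) fun a => ψ a).trans
        (MulChar.sum_eq_zero_of_ne_one hψ)
    rw [h, add_zero]
  have hmul : ∀ q r, ∑ n ∈ Finset.range (r + N * q), ψ n = ∑ n ∈ Finset.range r, ψ n := by
    intro q r
    induction q with
    | zero => simp
    | succ q ih => rw [Nat.mul_succ, ← add_assoc, hper, ih]
  rw [← Nat.mod_add_div M N, hmul]
  refine (norm_sum_le_of_le (f := fun n : ℕ => ψ n) _ fun n _ => ψ.norm_le_one n).trans ?_
  simpa using (Nat.mod_lt M (NeZero.pos N)).le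

theorem abs_sum_Ioc_le_of_dirichletCharacter {N : ℕ} [NeZero N] {ψ : DirichletCharacter ℂ N}
    (hψ : ψ ≠ 1) {χ : ℕ → ℤ} (hχ : ∀ n : ℕ, ψ n = χ n) (M : ℕ) :
    |∑ n ∈ Finset.Ioc 0 M, (χ n : ℝ)| ≤ N + 1 := by
  have h1 : ((∑ n ∈ Finset.Ioc 0 M, (χ n : ℝ) : ℝ) : ℂ) =
      ∑ n ∈ Finset.range (M + 1), ψ n - ψ (0 : ℕ) := by
    rw [sum_range_succ_eq_add_sum_Ioc fun n : ℕ => ψ n, add_sub_cancel_left]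
    simp only [hχ]
    push_cast
    rfl
  rw [← Real.norm_eq_abs, ← Complex.norm_real, h1]
  refine (norm_sub_le _ _).trans (add_le_add (ψ.norm_sum_range_le hψ _) (ψ.norm_le_one _))

/-- The pointwise product of an arithmetic function and a completely multiplicative function. -/
noncomputable def ArithmeticFunction.twist (h : ℕ → ℝ) (f : ArithmeticFunction ℝ) :
    ArithmeticFunction ℝ :=
  ⟨fun n => f n * h n, by simp⟩

theorem ArithmeticFunction.twist_apply (h : ℕ → ℝ) (f : ArithmeticFunction ℝ) (n : ℕ) :
    f.twist h n = f n * h n := rfl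

theorem ArithmeticFunction.twist_mul {h : ℕ → ℝ} (hh : ∀ m n, h (m * n) = h m * h n)
    (f g : ArithmeticFunction ℝ) : (f * g).twist h = f.twist h * g.twist h := by
  ext n
  simp only [twist_apply, mul_apply, Finset.sum_mul]
  refine Finset.sum_congr rfl fun x hx => ?_
  rw [← (Nat.mem_divisorsAntidiagonal.1 hx).1, hh]
  ring

open scoped ArithmeticFunction.Moebius in
theorem DirichletCharacter.tendsto_sum_mul_moebius_div {N : ℕ} [NeZero N]
    {ψ : DirichletCharacter ℂ N} (hψ : ψ ≠ 1) :
    Tendsto (fun M : ℕ => ∑ n ∈ Finset.Ioc 0 M, ψ n * (μ n : ℂ) / n) atTop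
      (nhds (ψ.LFunction 1)⁻¹) := by
  have h := tendsto_sum_div_of_LSeriesHasSum (a := fun n : ℕ => ψ n * (μ n : ℂ)) (C := 1)
    (F := fun z => (ψ.LFunction (1 + z))⁻¹) ?_ ?_ ?_
  · simpa using h
  · intro n
    rw [norm_mul]
    refine mul_le_one₀ (ψ.norm_le_one n) (norm_nonneg _) ?_
    rw [Complex.norm_intCast]
    exact_mod_cast ArithmeticFunction.abs_moebius_le_one
  · intro z hz
    refine DifferentiableAt.inv ?_ ?_
    · exact (ψ.differentiable_LFunction hψ _).comp z (by fun_prop)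
    · exact ψ.LFunction_ne_zero_of_one_le_re (Or.inl hψ) (by simpa using hz)
  · intro z hz
    have hs : 1 < (1 + z).re := by simpa using hz
    have h1 := ψ.LSeriesSummable_mul
      ((ArithmeticFunction.LSeriesSummable_moebius_iff (s := 1 + z)).2 hs)
    have h2 := LSeries.mul_mu_eq_one ψ hs
    rw [← ψ.LFunction_eq_LSeries hs] at h2
    have h3 := h1.LSeriesHasSum
    rw [eq_inv_of_mul_eq_one_right h2] at h3
    exact h3

open scoped ArithmeticFunction.Moebius ArithmeticFunction.vonMangoldt in
theorem exists_tendsto_sum_vonMangoldt_div {N : ℕ} [NeZero N] {ψ : DirichletCharacter ℂ N}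
    (hψ : ψ ≠ 1) {χ : ℕ → ℤ} (hχ : ∀ n : ℕ, ψ n = χ n) :
    ∃ L G : ℝ,
      Tendsto (fun M : ℕ => ∑ n ∈ Finset.Ioc 0 M, (χ n : ℝ) / n) atTop (nhds L) ∧
      Tendsto (fun M : ℕ => ∑ n ∈ Finset.Ioc 0 M, (χ n : ℝ) * Real.log n / n) atTop (nhds G) ∧
      Tendsto (fun M : ℕ => ∑ n ∈ Finset.Ioc 0 M, Λ n * ((χ n : ℝ) / n)) atTop
        (nhds (G / L)) := by
  have hB := abs_sum_Ioc_le_of_dirichletCharacter hψ hχ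
  obtain ⟨L, CL, hL, hL'⟩ := exists_abs_sum_Ioc_div_sub_le hB
  obtain ⟨G, CG, hG, hG'⟩ := exists_abs_sum_Ioc_mul_log_div_sub_le hB
  have hmul : ∀ m n, χ (m * n) = χ m * χ n := fun m n => by
    have h : ((χ (m * n) : ℤ) : ℂ) = χ m * χ n := by
      rw [← hχ, ← hχ, ← hχ, Nat.cast_mul, map_mul]
    exact_mod_cast h
  set h : ℕ → ℝ := fun n => (χ n : ℝ) / n with hh
  have hhmul : ∀ m n, h (m * n) = h m * h n := fun m n => by
    simp only [hh, hmul]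
    push_cast
    exact mul_div_mul_comm _ _ _ _
  have hχ1 : ∀ n, |(χ n : ℝ)| ≤ 1 := fun n => by
    have := ψ.norm_le_one n
    rw [hχ, Complex.norm_intCast] at this
    exact this
  set f := (μ : ArithmeticFunction ℝ).twist h with hf
  have hf1 : ∀ n : ℕ, |f n| ≤ 1 / n := fun n => by
    rw [hf, ArithmeticFunction.twist_apply, abs_mul, hh, abs_div, Nat.abs_cast, ← mul_div_assoc,
      ArithmeticFunction.intCoe_apply]
    refine div_le_div_of_nonneg_right (mul_le_one₀ ?_ (abs_nonneg _) (hχ1 n)) (by positivity)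
    exact_mod_cast ArithmeticFunction.abs_moebius_le_one
  obtain ⟨F, hF⟩ : ∃ F : ℝ, Tendsto (fun M : ℕ => ∑ n ∈ Finset.Ioc 0 M, f n) atTop (nhds F) := by
    refine ⟨((ψ.LFunction 1)⁻¹).re, ?_⟩
    refine ((Complex.continuous_re.tendsto _).comp
      (DirichletCharacter.tendsto_sum_mul_moebius_div hψ)).congr fun M => ?_
    rw [Function.comp_apply, Complex.re_sum]
    refine Finset.sum_congr rfl fun n _ => ?_
    have : ψ n * (μ n : ℂ) / n = ((f n : ℝ) : ℂ) := by
      rw [hf, ArithmeticFunction.twist_apply, hχ, hh, ArithmeticFunction.intCoe_apply]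
      push_cast
      ring
    rw [this, Complex.ofReal_re]
  have hFL : F * L = 1 := by
    have h1 := tendsto_sum_Ioc_convolution (f := f)
      (g := (ArithmeticFunction.zeta : ArithmeticFunction ℝ).twist h) (C' := CL) (G := L) hf1 hF ?_
    · refine tendsto_nhds_unique h1 (tendsto_const_nhds.congr' ?_)
      filter_upwards [eventually_ge_atTop 1] with M hM
      rw [hf, ← ArithmeticFunction.twist_mul hhmul, ArithmeticFunction.coe_moebius_mul_coe_zeta,
        Finset.sum_eq_single 1]
      · have : χ 1 = 1 := by
          have := hχ 1
          rw [Nat.cast_one, map_one] at this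
          exact_mod_cast this.symm
        simp [ArithmeticFunction.twist_apply, hh, this]
      · intro n _ hn
        rw [ArithmeticFunction.twist_apply, ArithmeticFunction.one_apply_ne hn, zero_mul]
      · intro h
        exact absurd (Finset.mem_Ioc.2 ⟨one_pos, hM⟩) h
    · intro M hM
      have : ∑ n ∈ Finset.Ioc 0 M, (ArithmeticFunction.zeta : ArithmeticFunction ℝ).twist h n =
          ∑ n ∈ Finset.Ioc 0 M, (χ n : ℝ) / n := by
        refine Finset.sum_congr rfl fun n hn => ?_
        rw [ArithmeticFunction.twist_apply, ArithmeticFunction.natCoe_apply,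
          ArithmeticFunction.zeta_apply_ne (Finset.mem_Ioc.1 hn).1.ne', Nat.cast_one, one_mul]
      rw [this]
      exact hL' M hM
  refine ⟨L, G, hL, hG, ?_⟩
  have h1 := tendsto_sum_Ioc_convolution (f := f)
    (g := ArithmeticFunction.log.twist h) (C' := CG) (G := G) hf1 hF ?_
  · rw [hf, ← ArithmeticFunction.twist_mul hhmul,
      ArithmeticFunction.moebius_mul_log_eq_vonMangoldt] at h1
    rw [div_eq_mul_inv, ← eq_inv_of_mul_eq_one_left hFL, mul_comm]
    exact h1
  · intro M hM
    have : ∑ n ∈ Finset.Ioc 0 M, ArithmeticFunction.log.twist h n =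
        ∑ n ∈ Finset.Ioc 0 M, (χ n : ℝ) * Real.log n / n := by
      refine Finset.sum_congr rfl fun n hn => ?_
      rw [ArithmeticFunction.twist_apply, ArithmeticFunction.log_apply, hh]
      ring
    rw [this]
    exact hG' M hM

theorem HasSum.of_support_subset_isPrimePow {f : ℕ → ℝ} (hf : Summable f)
    (hsupp : ∀ n, ¬ IsPrimePow n → f n = 0) {v : Nat.Primes → ℝ}
    (hv : ∀ p : Nat.Primes, HasSum (fun k : ℕ => f (p ^ (k + 1))) (v p)) :
    HasSum v (∑' n, f n) := by
  have h1 : HasSum (fun n : {n : ℕ // IsPrimePow n} => f n) (∑' n, f n) :=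
    (hasSum_subtype_iff_of_support_subset (s := {n | IsPrimePow n})
      fun n hn => by_contra fun h => hn (hsupp n h)).2 hf.hasSum
  have h2 := (Nat.Primes.prodNatEquiv.hasSum_iff).2 h1
  exact h2.prod_fiberwise fun p => by
    simpa [Function.comp_def, Nat.Primes.prodNatEquiv_apply] using hv p

open scoped ArithmeticFunction.vonMangoldt in
theorem hasSum_primes_log_mul {h : ℕ → ℝ} (hpow : ∀ p k, h (p ^ k) = h p ^ k)
    (hlt : ∀ p, p.Prime → |h p| < 1) (hs : Summable fun n => Λ n * h n) :
    HasSum (fun p : Nat.Primes => Real.log p * (h p / (1 - h p))) (∑' n, Λ n * h n) := by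
  refine HasSum.of_support_subset_isPrimePow hs (fun n hn => ?_) fun p => ?_
  · rw [ArithmeticFunction.vonMangoldt_eq_zero_iff.2 hn, zero_mul]
  · have := ((hasSum_geometric_of_abs_lt_one (hlt p p.2)).mul_left (h p)).mul_left (Real.log p)
    refine this.congr_fun fun k => ?_
    rw [ArithmeticFunction.vonMangoldt_apply_pow (Nat.succ_ne_zero k),
      ArithmeticFunction.vonMangoldt_apply_prime p.2, hpow, pow_succ']

open scoped ArithmeticFunction.vonMangoldt in
theorem hasSum_primes_log_mul_sq {h : ℕ → ℝ} (hpow : ∀ p k, h (p ^ k) = h p ^ k)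
    (hlt : ∀ p, p.Prime → |h p| < 1)
    (hs : Summable fun n : ℕ => if n.Prime then 0 else Λ n * h n) :
    HasSum (fun p : Nat.Primes => Real.log p * (h p / (1 - h p) - h p))
      (∑' n : ℕ, if n.Prime then 0 else Λ n * h n) := by
  refine HasSum.of_support_subset_isPrimePow hs (fun n hn => ?_) fun p => ?_
  · rw [ArithmeticFunction.vonMangoldt_eq_zero_iff.2 hn, zero_mul, ite_self]
  · have hp := hlt p p.2
    have h1 := ((hasSum_geometric_of_abs_lt_one hp).mul_left (h p ^ 2)).mul_left (Real.log p)
    have h2 : h p / (1 - h p) - h p = h p ^ 2 * (1 - h p)⁻¹ := by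
      have : 1 - h p ≠ 0 := by linarith [(abs_lt.1 hp).2]
      field_simp
      ring
    rw [h2, ← hasSum_nat_add_iff' 1, Finset.sum_range_one, zero_add, pow_one, if_pos p.2, sub_zero]
    refine h1.congr_fun fun k => ?_
    rw [if_neg (Nat.Prime.not_prime_pow (by omega)),
      ArithmeticFunction.vonMangoldt_apply_pow (by omega),
      ArithmeticFunction.vonMangoldt_apply_prime p.2, hpow]
    ring

theorem HasSum.tendsto_sum_primes {v : ℕ → ℝ} {S : ℝ}
    (h : HasSum (fun p : Nat.Primes => v p) S) :
    Tendsto (fun M : ℕ => ∑ p ∈ (Finset.Ioc 0 M).filter Nat.Prime, v p) atTop (nhds S) := by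
  have h1 : HasSum (({p | p.Prime} : Set ℕ).indicator v) S :=
    (hasSum_subtype_iff_indicator (s := {p : ℕ | p.Prime})).1 h
  refine ((h1.tendsto_sum_nat).comp (tendsto_add_atTop_nat 1)).congr fun M => ?_
  rw [Function.comp_apply, sum_range_succ_eq_add_sum_Ioc, Finset.sum_filter,
    Set.indicator_of_notMem (by simp [Nat.not_prime_zero]), _root_.zero_add]
  exact Finset.sum_congr rfl fun n _ => by simp [Set.indicator_apply]

theorem LSeries_ofReal {g : ℕ → ℝ} {s : ℝ} (hs : s ≠ 0) :
    LSeries (fun n => (g n : ℂ)) s = (∑' n : ℕ, g n * (n : ℝ) ^ (-s) : ℝ) ∧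
    (LSeriesSummable (fun n => (g n : ℂ)) s → Summable fun n : ℕ => g n * (n : ℝ) ^ (-s)) := by
  have h : LSeries.term (fun n => (g n : ℂ)) s = fun n : ℕ => ((g n * (n : ℝ) ^ (-s) : ℝ) : ℂ) := by
    ext n
    rcases eq_or_ne n 0 with rfl | hn
    · simp [Real.zero_rpow (neg_ne_zero.2 hs)]
    · rw [LSeries.term_of_ne_zero hn, Real.rpow_neg (by positivity), Complex.ofReal_mul,
        Complex.ofReal_inv, Complex.ofReal_cpow (by positivity), Complex.ofReal_natCast,
        div_eq_mul_inv]
  refine ⟨?_, fun hsum => ?_⟩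
  · rw [LSeries, h, Complex.ofReal_tsum]
  · rw [LSeriesSummable, h] at hsum
    exact Complex.summable_ofReal.1 hsum

open scoped ArithmeticFunction.vonMangoldt in
theorem neg_LChi'_div_LChi {N : ℕ} {ψ : DirichletCharacter ℂ N} {χ : ℕ → ℤ}
    (hχ : ∀ n : ℕ, ψ n = χ n) {s : ℝ} (hs : 1 < s) :
    (Summable fun n : ℕ => Λ n * ((χ n : ℝ) * (n : ℝ) ^ (-s))) ∧
    -(LChi' χ s / LChi χ s) = ∑' n : ℕ, Λ n * ((χ n : ℝ) * (n : ℝ) ^ (-s)) := by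
  have hs0 : s ≠ 0 := by linarith
  have hs1 : 1 < (s : ℂ).re := by simpa using hs
  have e1 : (fun n : ℕ => ψ n) = fun n : ℕ => (((χ n : ℝ)) : ℂ) := by
    ext n
    rw [hχ, Complex.ofReal_intCast]
  have e2 : (LSeries.logMul fun n : ℕ => ψ n) =
      fun n : ℕ => (((χ n : ℝ) * Real.log n : ℝ) : ℂ) := by
    ext n
    rw [LSeries.logMul, hχ, ← Complex.natCast_log]
    push_cast
    ring
  have e3 : ((fun n : ℕ => ψ n) * fun n : ℕ => ((Λ n : ℝ) : ℂ)) =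
      fun n : ℕ => ((Λ n * (χ n : ℝ) : ℝ) : ℂ) := by
    ext n
    rw [Pi.mul_apply, hχ]
    push_cast
    ring
  have h1 := (LSeries_ofReal (g := fun n => (χ n : ℝ)) hs0).1
  have h2 := (LSeries_ofReal (g := fun n => (χ n : ℝ) * Real.log n) hs0).1
  have h3 := LSeries_ofReal (g := fun n => Λ n * (χ n : ℝ)) hs0
  rw [← e1] at h1
  rw [← e2] at h2
  rw [← e3] at h3
  simp only [mul_assoc] at h3
  refine ⟨h3.2 (DirichletCharacter.LSeriesSummable_twist_vonMangoldt ψ hs1), ?_⟩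
  have h4 := DirichletCharacter.LSeries_twist_vonMangoldt_eq ψ hs1
  have habs : LSeries.abscissaOfAbsConv (fun n : ℕ => ψ n) < (s : ℂ).re :=
    (LSeries.abscissaOfAbsConv_le_of_forall_lt_LSeriesSummable' (x := 1) fun y hy =>
      ψ.LSeriesSummable_of_one_lt_re (by rw [Complex.ofReal_re]; exact_mod_cast hy)).trans_lt
        (by exact_mod_cast hs1)
  rw [LSeries_deriv habs, neg_neg, h1, h2, h3.1, ← Complex.ofReal_div, Complex.ofReal_inj] at h4
  rw [h4, LChi, LChi', neg_div, neg_neg]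

theorem one_lt_prime_pow_two_pow (p : Nat.Primes) (k : ℕ) : (1 : ℝ) < (p : ℝ) ^ 2 ^ k :=
  one_lt_pow₀ (by exact_mod_cast p.2.one_lt) (by positivity)

theorem summable_log_div_prime_pow_sub_one {k : ℕ} (hk : 1 ≤ k) :
    Summable fun p : Nat.Primes => Real.log p / ((p : ℝ) ^ 2 ^ k - 1) := by
  have hs : Summable fun p : Nat.Primes => 4 * ((p : ℕ) : ℝ) ^ (-(3 / 2) : ℝ) :=
    (Nat.Primes.summable_rpow.2 (by norm_num)).mul_left 4
  refine Summable.of_nonneg_of_le (fun p => ?_) (fun p => ?_) hs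
  · have := one_lt_prime_pow_two_pow p k
    exact div_nonneg (Real.log_natCast_nonneg _) (by linarith)
  · have hp2 : (2 : ℝ) ≤ (p : ℕ) := by exact_mod_cast p.2.two_le
    have hp0 : (0 : ℝ) < (p : ℕ) := by linarith
    have h1 : ((p : ℕ) : ℝ) ^ 2 ≤ ((p : ℕ) : ℝ) ^ 2 ^ k :=
      pow_le_pow_right₀ (by linarith) (by simpa using Nat.pow_le_pow_right two_pos hk)
    have h2 : ((p : ℕ) : ℝ) ^ 2 / 2 ≤ ((p : ℕ) : ℝ) ^ 2 ^ k - 1 := by nlinarith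
    have hlog := log_div_self_le_div_sqrt p
    have hsq : 0 < √((p : ℕ) : ℝ) := Real.sqrt_pos.2 hp0
    have h3 : ((p : ℕ) : ℝ) ^ (-(3 / 2) : ℝ) = 1 / (((p : ℕ) : ℝ) * √((p : ℕ) : ℝ)) := by
      rw [Real.rpow_neg hp0.le, Real.sqrt_eq_rpow, ← Real.rpow_one_add' hp0.le (by norm_num),
        one_div]
      norm_num
    rw [h3]
    calc Real.log p / (((p : ℕ) : ℝ) ^ 2 ^ k - 1)
        ≤ Real.log p / (((p : ℕ) : ℝ) ^ 2 / 2) :=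
          div_le_div_of_nonneg_left (Real.log_natCast_nonneg _) (by positivity) h2
      _ = Real.log p / p * (2 / p) := by field_simp
      _ ≤ 2 / √((p : ℕ) : ℝ) * (2 / p) := by gcongr
      _ = _ := by
          field_simp
          norm_num

/-- The contribution of a prime `p` with `χ p = -1` to `∑ 2 log p / (p ^ 2 ^ k - 1)`. -/
noncomputable def inertTerm (χ : ℕ → ℤ) (k p : ℕ) : ℝ :=
  if χ p = -1 then 2 * (Real.log p / ((p : ℝ) ^ 2 ^ k - 1)) else 0

theorem summable_inertTerm (χ : ℕ → ℤ) {k : ℕ} (hk : 1 ≤ k) :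
    Summable fun p : Nat.Primes => inertTerm χ k p := by
  have h := ((summable_log_div_prime_pow_sub_one hk).mul_left 2).indicator
    {p : Nat.Primes | χ p = -1}
  refine h.congr fun p => ?_
  simp [inertTerm, Set.indicator_apply]

theorem inertTerm_nonneg (χ : ℕ → ℤ) (k : ℕ) (p : Nat.Primes) : 0 ≤ inertTerm χ k p := by
  have := one_lt_prime_pow_two_pow p k
  have hlog := Real.log_natCast_nonneg (p : ℕ)
  unfold inertTerm
  split_ifs
  · exact mul_nonneg zero_le_two (div_nonneg hlog (by linarith))
  · rfl

theorem inertTerm_succ_le (χ : ℕ → ℤ) (k : ℕ) (p : Nat.Primes) :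
    inertTerm χ (k + 1) p ≤ inertTerm χ k p / 2 := by
  have h1 := one_lt_prime_pow_two_pow p k
  have hlog := Real.log_natCast_nonneg (p : ℕ)
  unfold inertTerm
  split_ifs
  · rw [pow_succ 2 k, pow_mul, mul_div_assoc, div_div]
    refine mul_le_mul_of_nonneg_left (div_le_div_of_nonneg_left hlog ?_ ?_) zero_le_two
    · linarith
    · nlinarith
  · simp

theorem tendsto_tsum_inertTerm (χ : ℕ → ℤ) :
    Tendsto (fun k => ∑' p : Nat.Primes, inertTerm χ (k + 1) p) atTop (nhds 0) := by
  have hle : ∀ k, ∑' p : Nat.Primes, inertTerm χ (k + 1) p ≤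
      (∑' p : Nat.Primes, inertTerm χ 1 p) * (1 / 2) ^ k := by
    intro k
    induction k with
    | zero => simp
    | succ k ih =>
      have h1 := (summable_inertTerm χ (k := k + 1 + 1) (by omega)).tsum_le_tsum
        (inertTerm_succ_le χ (k + 1)) ((summable_inertTerm χ (by omega)).div_const 2)
      rw [tsum_div_const] at h1
      rw [pow_succ]
      linarith
  refine squeeze_zero (fun k => tsum_nonneg (inertTerm_nonneg χ _)) hle ?_
  rw [← mul_zero (∑' p : Nat.Primes, inertTerm χ 1 p)]
  exact (tendsto_pow_atTop_nhds_zero_of_lt_one (by norm_num) (by norm_num)).const_mul _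

theorem hasSum_tsum_inertTerm_sub (χ : ℕ → ℤ) :
    HasSum (fun k => ∑' p : Nat.Primes, inertTerm χ (k + 2) p -
      ∑' p : Nat.Primes, inertTerm χ (k + 1) p) (-∑' p : Nat.Primes, inertTerm χ 1 p) := by
  have h : HasSum (fun k => ∑' p : Nat.Primes, inertTerm χ (k + 1) p -
      ∑' p : Nat.Primes, inertTerm χ (k + 2) p) (∑' p : Nat.Primes, inertTerm χ 1 p) := by
    rw [hasSum_iff_tendsto_nat_of_nonneg]
    · have h1 := (tendsto_tsum_inertTerm χ).const_sub (∑' p : Nat.Primes, inertTerm χ 1 p)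
      rw [sub_zero] at h1
      refine h1.congr fun n => ?_
      exact (Finset.sum_range_sub' (fun k => ∑' p : Nat.Primes, inertTerm χ (k + 1) p) n).symm
    · intro k
      rw [sub_nonneg]
      refine (summable_inertTerm χ (by omega)).tsum_le_tsum (fun p => ?_)
        (summable_inertTerm χ (by omega))
      have h1 := inertTerm_succ_le χ (k + 1) p
      have h2 := inertTerm_nonneg χ (k + 1) p
      linarith
  simpa using h.neg

theorem hasSum_primes_of_finset {s : Finset ℕ} (hs : ∀ p ∈ s, p.Prime) (v : ℕ → ℝ) :
    HasSum (fun p : Nat.Primes => if (p : ℕ) ∈ s then v p else 0) (∑ p ∈ s, v p) := by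
  have h : HasSum (fun n => if n ∈ s then v n else 0) (∑ p ∈ s, v p) := by
    have h1 : HasSum (fun n => if n ∈ s then v n else 0) (∑ p ∈ s, if p ∈ s then v p else 0) :=
      hasSum_sum_of_ne_finset_zero fun n hn => if_neg hn
    rwa [Finset.sum_congr rfl fun n hn => by rw [if_pos hn]] at h1
  have hsupp : Function.support (fun n => if n ∈ s then v n else 0) ⊆ {p : ℕ | p.Prime} := by
    intro n hn
    by_contra hn'
    exact hn (if_neg fun hmem => hn' (hs n hmem))
  exact (hasSum_subtype_iff_of_support_subset hsupp).2 h

theorem IsChiD.eq_zero_iff {D : ℤ} {χ : ℕ → ℤ} (hχ : IsChiD D χ) {p : ℕ} (hp : p.Prime) :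
    χ p = 0 ↔ (p : ℤ) ∣ D := by
  rw [hχ.2.2.2 p hp, kron]
  refine ⟨fun h => ?_, fun h => if_pos h⟩
  by_contra hpD
  rw [if_neg hpD] at h
  split_ifs at h
  · norm_num at h
  have : NeZero p := ⟨hp.ne_zero⟩
  rw [jacobiSym.eq_zero_iff_not_coprime] at h
  exact h (Nat.coprime_comm.1 ((hp.coprime_iff_not_dvd).2 fun h' => hpD (Int.natCast_dvd.2 h')))

theorem abs_div_lt_one_of_prime {χ : ℕ → ℤ} (hle : ∀ n, |χ n| ≤ 1) {s : ℝ} (hs : 0 < s) {p : ℕ}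
    (hp : p.Prime) : |(χ p : ℝ) * (p : ℝ) ^ (-s)| < 1 := by
  have h1 : |(χ p : ℝ)| ≤ 1 := by exact_mod_cast hle p
  have h2 : (p : ℝ) ^ (-s) < 1 :=
    Real.rpow_lt_one_of_one_lt_of_neg (by exact_mod_cast hp.one_lt) (by linarith)
  rw [abs_mul, abs_of_nonneg (by positivity : (0 : ℝ) ≤ (p : ℝ) ^ (-s))]
  exact (mul_le_of_le_one_left (by positivity) h1).trans_lt h2

theorem abs_le_one_of_dirichletCharacter {N : ℕ} {ψ : DirichletCharacter ℂ N} {χ : ℕ → ℤ}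
    (hχ : ∀ n : ℕ, ψ n = χ n) (n : ℕ) : |χ n| ≤ 1 := by
  have := ψ.norm_le_one n
  rw [hχ, Complex.norm_intCast] at this
  exact_mod_cast this

theorem map_pow_of_dirichletCharacter {N : ℕ} {ψ : DirichletCharacter ℂ N} {χ : ℕ → ℤ}
    (hχ : ∀ n : ℕ, ψ n = χ n) (m k : ℕ) : χ (m ^ k) = χ m ^ k := by
  have : ((χ (m ^ k) : ℤ) : ℂ) = χ m ^ k := by
    rw [← hχ, ← hχ, Nat.cast_pow, map_pow]
  exact_mod_cast this

theorem hasSum_primes_neg_LChi'_div_LChi {N : ℕ} {ψ : DirichletCharacter ℂ N} {χ : ℕ → ℤ}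
    (hχ : ∀ n : ℕ, ψ n = χ n) (k : ℕ) :
    HasSum (fun p : Nat.Primes => Real.log p * ((χ p : ℝ) / ((p : ℝ) ^ 2 ^ (k + 1) - χ p)))
      (-(LChi' χ ((2 : ℝ) ^ (k + 1)) / LChi χ ((2 : ℝ) ^ (k + 1)))) := by
  have hs : (1 : ℝ) < 2 ^ (k + 1) := one_lt_pow₀ one_lt_two (Nat.succ_ne_zero k)
  have hle := abs_le_one_of_dirichletCharacter hχ
  have hpow := map_pow_of_dirichletCharacter hχ
  obtain ⟨h1, h2⟩ := neg_LChi'_div_LChi hχ hs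
  rw [h2]
  refine (hasSum_primes_log_mul (fun p k => ?_) (fun p hp => ?_) h1).congr_fun fun p => ?_
  · rw [hpow, mul_pow, Nat.cast_pow, Int.cast_pow, Real.rpow_pow_comm (by positivity)]
  · exact abs_div_lt_one_of_prime hle (by positivity) hp
  · have hq : (((p : ℕ) : ℝ) ^ (-(2 : ℝ) ^ (k + 1))) = (((p : ℕ) : ℝ) ^ 2 ^ (k + 1))⁻¹ := by
      have h3 : ((2 ^ (k + 1) : ℕ) : ℝ) = (2 : ℝ) ^ (k + 1) := Nat.cast_pow 2 (k + 1)
      rw [Real.rpow_neg (by positivity), ← h3, Real.rpow_natCast]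
    have h3 := one_lt_prime_pow_two_pow p (k + 1)
    have h4 : (χ p : ℝ) ≤ 1 := by exact_mod_cast (le_abs_self _).trans (hle p)
    rw [hq]
    generalize ((p : ℕ) : ℝ) ^ 2 ^ (k + 1) = q at *
    have h5 : q - (χ p : ℝ) ≠ 0 := by linarith
    have h6 : 1 - (χ p : ℝ) * q⁻¹ ≠ 0 := by
      have : q ≠ 0 := by linarith
      field_simp
      exact div_ne_zero h5 this
    have : q ≠ 0 := by linarith
    field_simp

theorem hasSum_primes_neg_zetaR'_div_zetaR (k : ℕ) :
    HasSum (fun p : Nat.Primes => Real.log p / ((p : ℝ) ^ 2 ^ (k + 1) - 1))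
      (-(zetaR' ((2 : ℝ) ^ (k + 1)) / zetaR ((2 : ℝ) ^ (k + 1)))) := by
  have h := hasSum_primes_neg_LChi'_div_LChi (N := 1) (ψ := 1) (χ := fun _ => 1) (fun n => by
    rw [MulChar.one_apply (isUnit_of_subsingleton _), Int.cast_one]) k
  simpa [LChi, LChi', zetaR, zetaR', div_eq_mul_inv] using h

theorem eq_neg_one_or_zero_or_one {a : ℤ} (h : |a| ≤ 1) : a = -1 ∨ a = 0 ∨ a = 1 := by
  rw [abs_le] at h
  omega

theorem IsChiD.term_eq_tsum_inertTerm_sub {D : ℤ} {χ : ℕ → ℤ} (hχD : IsChiD D χ) (hD : D ≠ 0)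
    {N : ℕ} {ψ : DirichletCharacter ℂ N} (hχ : ∀ n : ℕ, ψ n = χ n) (k : ℕ) :
    -(LChi' χ ((2 : ℝ) ^ (k + 1)) / LChi χ ((2 : ℝ) ^ (k + 1))) +
        zetaR' ((2 : ℝ) ^ (k + 1)) / zetaR ((2 : ℝ) ^ (k + 1)) +
        ∑ p ∈ D.natAbs.primeFactors, Real.log p / ((p : ℝ) ^ 2 ^ (k + 1) - 1) =
      ∑' p : Nat.Primes, inertTerm χ (k + 2) p - ∑' p : Nat.Primes, inertTerm χ (k + 1) p := by
  have hle := abs_le_one_of_dirichletCharacter hχ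
  have h1 := ((hasSum_primes_neg_LChi'_div_LChi hχ k).sub
    (hasSum_primes_neg_zetaR'_div_zetaR k)).add (hasSum_primes_of_finset
      (s := D.natAbs.primeFactors) (fun p hp => Nat.prime_of_mem_primeFactors hp)
      fun p => Real.log p / ((p : ℝ) ^ 2 ^ (k + 1) - 1))
  rw [sub_neg_eq_add] at h1
  refine h1.unique (((summable_inertTerm χ (by omega)).hasSum.sub
    (summable_inertTerm χ (by omega)).hasSum).congr_fun fun p => ?_)
  have hmem : (p : ℕ) ∈ D.natAbs.primeFactors ↔ χ p = 0 := by
    rw [hχD.eq_zero_iff p.2, Nat.mem_primeFactors, Int.natCast_dvd]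
    have := p.2
    have := Int.natAbs_ne_zero.2 hD
    tauto
  have h3 := one_lt_prime_pow_two_pow p (k + 1)
  have hq : ((p : ℕ) : ℝ) ^ 2 ^ (k + 2) = (((p : ℕ) : ℝ) ^ 2 ^ (k + 1)) ^ 2 := by
    rw [← pow_mul, ← pow_succ]
  unfold inertTerm
  simp only [hmem]
  rw [hq]
  generalize ((p : ℕ) : ℝ) ^ 2 ^ (k + 1) = q at *
  have h4 : q - 1 ≠ 0 := by linarith
  have h5 : q + 1 ≠ 0 := by linarith
  have h6 : q ^ 2 - 1 ≠ 0 := by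
    rw [show q ^ 2 - 1 = (q - 1) * (q + 1) by ring]
    exact mul_ne_zero h4 h5
  rcases eq_neg_one_or_zero_or_one (hle p) with h | h | h
  · rw [h, if_pos rfl, if_pos rfl, if_neg (by norm_num)]
    push_cast
    rw [sub_neg_eq_add]
    field_simp
    ring
  · rw [h, if_pos rfl, if_neg (by norm_num), if_neg (by norm_num)]
    simp
  · rw [h, if_neg (by norm_num), if_neg (by norm_num), if_neg (by norm_num)]
    simp [div_eq_mul_inv]

open scoped ArithmeticFunction.vonMangoldt in
theorem summable_not_prime_vonMangoldt_mul {χ : ℕ → ℤ} (hle : ∀ n, |χ n| ≤ 1) :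
    Summable fun n : ℕ => if n.Prime then 0 else Λ n * ((χ n : ℝ) / n) := by
  refine Summable.of_norm_bounded
    (ArithmeticFunction.vonMangoldt.summable_residueClass_non_primes_div (0 : ZMod 1)) fun n => ?_
  have h : ArithmeticFunction.vonMangoldt.residueClass (0 : ZMod 1) n = Λ n := by
    rw [ArithmeticFunction.vonMangoldt.residueClass, Set.indicator_of_mem]
    exact Subsingleton.elim _ _
  rw [h]
  split_ifs
  · simp
  · have h1 : |(χ n : ℝ)| ≤ 1 := by exact_mod_cast hle n
    rw [Real.norm_eq_abs, abs_mul, abs_div, Nat.abs_cast, mul_div_assoc',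
      abs_of_nonneg ArithmeticFunction.vonMangoldt_nonneg]
    exact div_le_div_of_nonneg_right
      (mul_le_of_le_one_right ArithmeticFunction.vonMangoldt_nonneg h1) (by positivity)

open scoped ArithmeticFunction.vonMangoldt in
theorem tendsto_sum_primes_log_div_sub_one {χ : ℕ → ℤ} (hle : ∀ n, |χ n| ≤ 1)
    (hpow : ∀ p k, χ (p ^ k) = χ p ^ k) {A : ℝ}
    (hA : Tendsto (fun M : ℕ => ∑ n ∈ Finset.Ioc 0 M, Λ n * ((χ n : ℝ) / n)) atTop (nhds A)) :
    Tendsto (fun M : ℕ => ∑ p ∈ (Finset.Ioc 0 M).filter Nat.Prime,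
      (χ p : ℝ) * Real.log p / ((p : ℝ) - 1)) atTop
      (nhds (A - ∑' p : Nat.Primes, inertTerm χ 1 p)) := by
  have hR := summable_not_prime_vonMangoldt_mul hle
  have hlt : ∀ p : ℕ, p.Prime → |(χ p : ℝ) / p| < 1 := fun p hp => by
    simpa [Real.rpow_neg_one, div_eq_mul_inv] using abs_div_lt_one_of_prime hle one_pos hp
  have h1 := hasSum_primes_log_mul_sq (h := fun n => (χ n : ℝ) / n) (fun p k => by
    simp only [hpow]
    push_cast
    rw [div_pow]) hlt hR
  have h2 := (HasSum.tendsto_sum_primes (v := fun p : ℕ => Real.log p *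
    ((χ p : ℝ) / p / (1 - (χ p : ℝ) / p) - (χ p : ℝ) / p)) h1).sub
    (HasSum.tendsto_sum_primes (summable_inertTerm χ le_rfl).hasSum)
  have h3 := (hR.hasSum.tendsto_sum_nat).comp (tendsto_add_atTop_nat 1)
  have h4 := (hA.sub h3).add h2
  rw [show A - ∑' p : Nat.Primes, inertTerm χ 1 p = _ from (sub_add_sub_cancel A _ _).symm]
  refine h4.congr fun M => ?_
  · rw [Function.comp_apply, sum_range_succ_eq_add_sum_Ioc, ← Finset.sum_sub_distrib]
    have h0 : (if Nat.Prime 0 then 0 else Λ 0 * ((χ 0 : ℝ) / (0 : ℕ))) = 0 := by simp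
    rw [h0, zero_add, ← Finset.sum_sub_distrib, Finset.sum_filter, Finset.sum_filter,
      ← Finset.sum_add_distrib]
    refine Finset.sum_congr rfl fun p _ => ?_
    by_cases hp : p.Prime
    · have hp1 : (1 : ℝ) < p := by exact_mod_cast hp.one_lt
      have h5 : (p : ℝ) - 1 ≠ 0 := by linarith
      have h6 : (p : ℝ) + 1 ≠ 0 := by linarith
      have h7 : (p : ℝ) ≠ 0 := by linarith
      simp only [if_pos hp, ArithmeticFunction.vonMangoldt_apply_prime hp, inertTerm]
      rcases eq_neg_one_or_zero_or_one (hle p) with h | h | h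
      · have h8 : (p : ℝ) ^ 2 - 1 ≠ 0 := by
          rw [show (p : ℝ) ^ 2 - 1 = (p - 1) * (p + 1) by ring]
          exact mul_ne_zero h5 h6
        have h9 : 1 - (-1 : ℝ) / p ≠ 0 := by
          rw [show 1 - (-1 : ℝ) / p = (p + 1) / p by field_simp; ring]
          exact div_ne_zero h6 h7
        rw [h, if_pos rfl, pow_one]
        push_cast
        rw [show (-1 : ℝ) / p / (1 - -1 / p) = -1 / (p + 1) by
          rw [div_div, mul_sub, mul_one, mul_div_cancel₀ _ h7, sub_neg_eq_add]]
        field_simp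
        ring
      · simp [h]
      · rw [h, if_neg (by norm_num)]
        push_cast
        rw [show (1 : ℝ) / p / (1 - 1 / p) = 1 / (p - 1) by
          rw [div_div, mul_sub, mul_one, mul_div_cancel₀ _ h7]]
        ring
    · simp [hp]

/-- For a fundamental discriminant `D ≤ -3`, the limit
`lim_{x→∞} ∑_{p ≤ x} (D/p) log p/(p - 1)` exists and equals
`-(L'/L)(1,χ_D) + ∑_{k ≥ 1} (-(L'/L)(2ᵏ,χ_D) + (ζ'/ζ)(2ᵏ) + ∑_{p ∣ D} log p/(p^{2ᵏ} - 1))`,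
where `L = L(1,χ_D)`, `L' = L'(1,χ_D)` are the limits of the partial sums of
`∑ χ_D(n)/n` and `-∑ χ_D(n) log n / n`, and the series over `k` converges. -/
theorem cilleruelo_formula (D : ℤ) (hD : D ≤ -3)
    (hfund : IsFundamentalDiscriminant D) (χD : ℕ → ℤ) (hχ : IsChiD D χD) :
    ∃ L L' : ℝ,
      Tendsto (fun N : ℕ => ∑ n ∈ Finset.range N, (χD n : ℝ) / (n : ℝ)) atTop (nhds L) ∧
      Tendsto (fun N : ℕ => -∑ n ∈ Finset.range N, (χD n : ℝ) * Real.log n / (n : ℝ))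
        atTop (nhds L') ∧
      Summable (fun k : ℕ =>
        -(LChi' χD ((2 : ℝ) ^ (k + 1)) / LChi χD ((2 : ℝ) ^ (k + 1))) +
          zetaR' ((2 : ℝ) ^ (k + 1)) / zetaR ((2 : ℝ) ^ (k + 1)) +
          ∑ p ∈ D.natAbs.primeFactors, Real.log p / ((p : ℝ) ^ 2 ^ (k + 1) - 1)) ∧
      Tendsto (fun x : ℝ =>
          ∑ p ∈ (Finset.Icc 1 ⌊x⌋₊).filter Nat.Prime,
            (kron D p : ℝ) * Real.log p / ((p : ℝ) - 1))
        atTop (nhds (-(L' / L) +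
          ∑' k : ℕ,
            (-(LChi' χD ((2 : ℝ) ^ (k + 1)) / LChi χD ((2 : ℝ) ^ (k + 1))) +
              zetaR' ((2 : ℝ) ^ (k + 1)) / zetaR ((2 : ℝ) ^ (k + 1)) +
              ∑ p ∈ D.natAbs.primeFactors, Real.log p / ((p : ℝ) ^ 2 ^ (k + 1) - 1)))) := by
  obtain ⟨N, hN, ψ, hψ, hψχ⟩ := hχ.exists_dirichletCharacter hD hfund
  have : NeZero N := ⟨hN⟩
  obtain ⟨L, G, hL, hG, hA⟩ := exists_tendsto_sum_vonMangoldt_div hψ hψχ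
  have hle := abs_le_one_of_dirichletCharacter hψχ
  have hterm := hasSum_tsum_inertTerm_sub χD
  simp only [← hχ.term_eq_tsum_inertTerm_sub (by omega) hψχ] at hterm
  refine ⟨L, -G, ?_, ?_, hterm.summable, ?_⟩
  · refine (tendsto_add_atTop_iff_nat 1).1 (hL.congr fun M => ?_)
    rw [sum_range_succ_eq_add_sum_Ioc]
    simp
  · refine (tendsto_add_atTop_iff_nat 1).1 (hG.neg.congr fun M => ?_)
    rw [sum_range_succ_eq_add_sum_Ioc]
    simp
  · rw [hterm.tsum_eq, neg_div, neg_neg, ← sub_eq_add_neg]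
    refine ((tendsto_sum_primes_log_div_sub_one hle (map_pow_of_dirichletCharacter hψχ) hA).comp
      tendsto_nat_floor_atTop).congr fun x => ?_
    refine Finset.sum_congr rfl fun p hp => ?_
    rw [hχ.2.2.2 p (Finset.mem_filter.1 hp).2]
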